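/- arXiv:2210.14340 — 2 statements merged into one kernel-verified Lean document; each statement's English description precedes it below -/
import Mathlib

section
/- Let f ∈ Lip_p admit a measurable direction of steepest ascent. Then lim_{h↓0} (I(h)f − μf)/h = φ*(‖ |f|_Lip ‖_{L_q(μ)}), where μf := ∫_X f dμ, φ* is the convex conjugate of φ, and q = p/(p−1). -/
open MeasureTheory Filter Set
open scoped Topology ENNReal NNReal RealInnerProductSpace

noncomputable section

variable {X : Type*} [NormedAddCommGroup X] [InnerProductSpace ℝ X]
  [SecondCountableTopology X] [CompleteSpace X] [MeasurableSpace X] [BorelSpace X]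

/-- `π` is a coupling of `μ` and `ν`. -/
def IsCoupling (μ ν : Measure X) (π : Measure (X × X)) : Prop :=
  π.map Prod.fst = μ ∧ π.map Prod.snd = ν

/-- The `p`-Wasserstein distance between `μ` and `ν` (valued in `ℝ≥0∞`). -/
def Wp (p : ℝ) (μ ν : Measure X) : ℝ≥0∞ :=
  (⨅ π ∈ {π : Measure (X × X) | IsCoupling μ ν π},
    ∫⁻ q, (‖q.1 - q.2‖₊ : ℝ≥0∞) ^ p ∂π) ^ (1 / p)

/-- Borel probability measures with finite `p`-th moment. -/
def Pp (p : ℝ) : Set (Measure X) :=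
  {ν | IsProbabilityMeasure ν ∧ ∫⁻ x, (‖x‖₊ : ℝ≥0∞) ^ p ∂ν < ⊤}

/-- The rescaled penalty function `φ_h(v) = h·φ(v/h)`. -/
def phih (φ : ℝ → ℝ≥0∞) (h v : ℝ) : ℝ≥0∞ := ENNReal.ofReal h * φ (v / h)

/-- The risk functional `I(h) f`. -/
def Ifun (μ : Measure X) (φ : ℝ → ℝ≥0∞) (p h : ℝ) (f : X → ℝ) : EReal :=
  ⨆ ν ∈ Pp (X := X) p,
    ((∫ x, f x ∂ν : ℝ) : EReal) - ((phih φ h (Wp p μ ν).toReal : ℝ≥0∞) : EReal)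

/-- The `L_p(μ; X)` norm of a vector field. -/
def lpnorm (μ : Measure X) (p : ℝ) (θ : X → X) : ℝ := (∫ y, ‖θ y‖ ^ p ∂μ) ^ (1 / p)

/-- The parametric risk functional `I_Θ(h) f`, where `μ_θ` is the pushforward of `μ`
under `y ↦ y + θ(y)`. -/
def ITheta (μ : Measure X) (φ : ℝ → ℝ≥0∞) (p : ℝ) (Θ : Set (X → X)) (h : ℝ)
    (f : X → ℝ) : EReal :=
  ⨆ θ ∈ Θ, ((∫ x, f x ∂(μ.map fun y => y + θ y) : ℝ) : EReal)
    - ((phih φ h (lpnorm μ p θ) : ℝ≥0∞) : EReal)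

/-- Membership in `Lip_p`. -/
def MemLipP (p : ℝ) (f : X → ℝ) : Prop :=
  ∃ L : ℝ, 0 ≤ L ∧ ∀ x₁ x₂ : X,
    |f x₁ - f x₂| ≤ L * (1 + max ‖x₁‖ ‖x₂‖) ^ (p - 1) * ‖x₁ - x₂‖

/-- The local Lipschitz constant `|f|_Lip`. -/
def locLip (f : X → ℝ) (x : X) : ℝ :=
  limsup (fun h : ℝ =>
      sSup ((fun u : X => (f (x + h • u) - f x) / h) '' {u : X | ‖u‖ = 0 ∨ ‖u‖ = 1}))
    (𝓝[>] (0 : ℝ))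

/-- `v` is a measurable direction of steepest ascent for `f`. -/
def SteepestAscent (f : X → ℝ) (v : X → X) : Prop :=
  Measurable v ∧ ∀ x : X, (‖v x‖ = 0 ∨ ‖v x‖ = 1) ∧
    Tendsto (fun h : ℝ => (f (x + h • v x) - f x) / h) (𝓝[>] (0 : ℝ)) (𝓝 (locLip f x))

/-- The convex conjugate `φ*` of the penalty function. -/
def phiStar (φ : ℝ → ℝ≥0∞) (u : ℝ) : EReal :=
  ⨆ v ∈ Ici (0 : ℝ), ((u * v : ℝ) : EReal) - ((φ v : ℝ≥0∞) : EReal)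

set_option linter.unusedSectionVars false

/-- Increments of a function in `Lip_p`, bounded in terms of the base point and the step. -/
def IncrementBound (f : X → ℝ) (c p : ℝ) : Prop :=
  ∀ x z : X, |f z - f x| ≤ c * ((1 + ‖x‖) ^ (p - 1) + ‖z - x‖ ^ (p - 1)) * ‖z - x‖

theorem add_rpow_le_two_rpow_mul {a b s : ℝ} (ha : 0 ≤ a) (hb : 0 ≤ b) (hs : 0 ≤ s) :
    (a + b) ^ s ≤ 2 ^ s * (a ^ s + b ^ s) := by
  have h1 : (a + b) ^ s ≤ (2 * max a b) ^ s :=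
    Real.rpow_le_rpow (by positivity)
      (by linarith [le_max_left a b, le_max_right a b]) hs
  rw [Real.mul_rpow (by norm_num) (le_max_of_le_left ha)] at h1
  refine h1.trans (mul_le_mul_of_nonneg_left ?_ (by positivity))
  have := Real.rpow_nonneg ha s
  have := Real.rpow_nonneg hb s
  rcases max_cases a b with ⟨h, -⟩ | ⟨h, -⟩ <;> rw [h] <;> linarith

theorem rpow_sub_one_mul_self {t p : ℝ} (ht : 0 ≤ t) (hp : 1 < p) :
    t ^ (p - 1) * t = t ^ p := by
  rcases ht.eq_or_lt with rfl | ht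
  · rw [mul_zero, Real.zero_rpow (by linarith)]
  · rw [Real.rpow_sub_one ht.ne']; field_simp

theorem rpow_sub_one_mul_le {a b p : ℝ} (ha : 0 ≤ a) (hb : 0 ≤ b) (hp : 1 < p) :
    a ^ (p - 1) * b ≤ a ^ p + b ^ p := by
  have hpa := Real.rpow_nonneg ha p
  have hpb := Real.rpow_nonneg hb p
  rcases le_total a b with h | h
  · have : a ^ (p - 1) * b ≤ b ^ (p - 1) * b :=
      mul_le_mul_of_nonneg_right (Real.rpow_le_rpow ha h (by linarith)) hb
    rw [rpow_sub_one_mul_self hb hp] at this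
    linarith
  · have : a ^ (p - 1) * b ≤ a ^ (p - 1) * a :=
      mul_le_mul_of_nonneg_left h (Real.rpow_nonneg ha _)
    rw [rpow_sub_one_mul_self ha hp] at this
    linarith

theorem MemLipP.exists_incrementBound {f : X → ℝ} {p : ℝ} (hp : 1 < p) (hf : MemLipP p f) :
    ∃ c : ℝ, 0 < c ∧ IncrementBound f c p := by
  obtain ⟨L, hL, h⟩ := hf
  refine ⟨(L + 1) * 2 ^ (p - 1), by positivity, fun x z => (h z x).trans ?_⟩
  refine mul_le_mul_of_nonneg_right ?_ (norm_nonneg _)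
  rw [mul_assoc]
  have hz : ‖z‖ ≤ ‖x‖ + ‖z - x‖ := by
    calc ‖z‖ = ‖x + (z - x)‖ := by congr 1; abel
      _ ≤ _ := norm_add_le _ _
  have hm : 1 + max ‖z‖ ‖x‖ ≤ (1 + ‖x‖) + ‖z - x‖ := by
    have : max ‖z‖ ‖x‖ ≤ ‖x‖ + ‖z - x‖ := max_le hz (by linarith [norm_nonneg (z - x)])
    linarith
  have h0 : 0 ≤ 1 + max ‖z‖ ‖x‖ := by positivity
  exact mul_le_mul (by linarith) ((Real.rpow_le_rpow h0 hm (by linarith)).trans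
    (add_rpow_le_two_rpow_mul (by positivity) (by positivity) (by linarith)))
    (Real.rpow_nonneg h0 _) (by linarith)

theorem IncrementBound.continuous {f : X → ℝ} {c p : ℝ} (hp : 1 < p)
    (h : IncrementBound f c p) : Continuous f := by
  rw [continuous_iff_continuousAt]
  intro x
  rw [ContinuousAt, tendsto_iff_norm_sub_tendsto_zero]
  have hcont : Continuous fun z : X =>
      c * ((1 + ‖x‖) ^ (p - 1) + ‖z - x‖ ^ (p - 1)) * ‖z - x‖ := by
    have : Continuous fun z : X => ‖z - x‖ ^ (p - 1) :=
      (by fun_prop : Continuous fun z : X => ‖z - x‖).rpow_const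
        fun _ => Or.inr (by linarith)
    fun_prop
  refine squeeze_zero (fun _ => norm_nonneg _) (fun z => h x z) ?_
  simpa using hcont.tendsto x

theorem integrable_norm_rpow {ν : Measure X} {p : ℝ} (hp : 1 < p) (hν : ν ∈ Pp (X := X) p) :
    Integrable (fun x => ‖x‖ ^ p) ν := by
  refine ⟨(continuous_norm.rpow_const
    fun _ => Or.inr (by linarith)).aestronglyMeasurable, ?_⟩
  rw [hasFiniteIntegral_iff_ofReal (ae_of_all _ fun x => by positivity)]
  refine lt_of_eq_of_lt (lintegral_congr fun x => ?_) hν.2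
  rw [← ENNReal.ofReal_rpow_of_nonneg (norm_nonneg _) (by linarith), ofReal_norm]
  rfl

theorem integrable_one_add_norm_rpow {ν : Measure X} {p : ℝ} (hp : 1 < p)
    (hν : ν ∈ Pp (X := X) p) : Integrable (fun x => (1 + ‖x‖) ^ p) ν := by
  have := hν.1
  refine (((integrable_const 1).add (integrable_norm_rpow hp hν)).const_mul (2 ^ p)).mono'
    ((continuous_const.add continuous_norm).rpow_const
      fun _ => Or.inr (by linarith)).aestronglyMeasurable (ae_of_all _ fun x => ?_)
  rw [Real.norm_of_nonneg (by positivity)]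
  simpa using add_rpow_le_two_rpow_mul (s := p) zero_le_one (norm_nonneg x) (by linarith)

theorem IncrementBound.integrable {f : X → ℝ} {c p : ℝ} (hp : 1 < p) (hc : 0 < c)
    (h : IncrementBound f c p) {ν : Measure X} (hν : ν ∈ Pp (X := X) p) : Integrable f ν := by
  have := hν.1
  have hi := integrable_one_add_norm_rpow hp hν
  refine ((integrable_const |f 0|).add (hi.const_mul (2 * c))).mono'
    (h.continuous hp).aestronglyMeasurable (ae_of_all _ fun x => ?_)
  have h1 := h 0 x
  simp only [norm_zero, add_zero, Real.one_rpow, sub_zero] at h1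
  have h2 : |f x| ≤ |f 0| + |f x - f 0| := by
    simpa using abs_add_le (f 0) (f x - f 0)
  have h3 : ‖x‖ ^ (p - 1) ≤ (1 + ‖x‖) ^ (p - 1) :=
    Real.rpow_le_rpow (norm_nonneg _) (by linarith) (by linarith)
  have h4 : (1:ℝ) ≤ (1 + ‖x‖) ^ (p - 1) :=
    Real.one_le_rpow (by linarith [norm_nonneg x]) (by linarith)
  have h5 := rpow_sub_one_mul_self (t := 1 + ‖x‖) (by positivity) hp
  have h6 : (1 + ‖x‖ ^ (p - 1)) * ‖x‖ ≤ 2 * (1 + ‖x‖) ^ p := by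
    calc (1 + ‖x‖ ^ (p - 1)) * ‖x‖ ≤ (2 * (1 + ‖x‖) ^ (p - 1)) * (1 + ‖x‖) :=
          mul_le_mul (by linarith) (by linarith) (norm_nonneg _) (by positivity)
      _ = _ := by rw [mul_assoc, h5]
  simp only [Pi.add_apply, Real.norm_eq_abs]
  nlinarith [mul_le_mul_of_nonneg_left h6 hc.le]

theorem IncrementBound.div_le {f : X → ℝ} {c p : ℝ} (h : IncrementBound f c p)
    (hc : 0 < c) {r : ℝ} (hr : 0 < r) {x u : X} (hu : ‖u‖ = 0 ∨ ‖u‖ = 1) :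
    (f (x + r • u) - f x) / r ≤ c * ((1 + ‖x‖) ^ (p - 1) + r ^ (p - 1)) := by
  rw [div_le_iff₀ hr]
  have h1 := (le_abs_self _).trans (h x (x + r • u))
  rcases hu with hu | hu
  · rw [norm_eq_zero] at hu
    subst hu
    simp only [smul_zero, add_zero, sub_self]
    positivity
  · rwa [add_sub_cancel_left, norm_smul, hu, mul_one, Real.norm_of_nonneg hr.le] at h1

theorem IncrementBound.bddAbove_quotients {f : X → ℝ} {c p : ℝ} (h : IncrementBound f c p)
    (hc : 0 < c) {r : ℝ} (hr : 0 < r) (x : X) :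
    BddAbove ((fun u : X => (f (x + r • u) - f x) / r) '' {u : X | ‖u‖ = 0 ∨ ‖u‖ = 1}) := by
  refine ⟨c * ((1 + ‖x‖) ^ (p - 1) + r ^ (p - 1)), ?_⟩
  rintro _ ⟨u, hu, rfl⟩
  exact h.div_le hc hr hu

theorem IncrementBound.isBoundedUnder {f : X → ℝ} {c p : ℝ} (h : IncrementBound f c p)
    (hc : 0 < c) (hp : 1 < p) (x : X) :
    IsBoundedUnder (· ≤ ·) (𝓝[>] (0 : ℝ)) (fun r : ℝ =>
      sSup ((fun u : X => (f (x + r • u) - f x) / r) '' {u : X | ‖u‖ = 0 ∨ ‖u‖ = 1})) := by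
  refine isBoundedUnder_of_eventually_le (a := c * ((1 + ‖x‖) ^ (p - 1) + 1)) ?_
  filter_upwards [Ioo_mem_nhdsGT zero_lt_one] with r hr
  refine csSup_le ⟨_, mem_image_of_mem _ (Or.inl norm_zero)⟩ ?_
  rintro _ ⟨u, hu, rfl⟩
  refine (h.div_le hc hr.1 hu).trans ?_
  gcongr
  exact Real.rpow_le_one hr.1.le hr.2.le (by linarith)

theorem IncrementBound.locLip_nonneg {f : X → ℝ} {c p : ℝ} (h : IncrementBound f c p)
    (hc : 0 < c) (hp : 1 < p) (x : X) : 0 ≤ locLip f x := by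
  refine le_limsup_of_frequently_le (Eventually.frequently ?_) (h.isBoundedUnder hc hp x)
  filter_upwards [self_mem_nhdsWithin] with r hr
  refine le_csSup (h.bddAbove_quotients hc hr x) ⟨0, Or.inl norm_zero, ?_⟩
  simp

theorem IncrementBound.exists_sub_le {f : X → ℝ} {c p : ℝ} (h : IncrementBound f c p)
    (hc : 0 < c) (hp : 1 < p) (x : X) {ε : ℝ} (hε : 0 < ε) :
    ∃ r > 0, ∀ z, ‖z - x‖ < r → f z - f x ≤ (locLip f x + ε) * ‖z - x‖ := by
  have h1 := eventually_lt_of_limsup_lt (show locLip f x < locLip f x + ε by linarith)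
    (h.isBoundedUnder hc hp x)
  obtain ⟨r, hr, h2⟩ := mem_nhdsGT_iff_exists_Ioo_subset.1 h1
  refine ⟨r, hr, fun z hz => ?_⟩
  rcases eq_or_ne z x with rfl | hzx
  · simp
  have hd : 0 < ‖z - x‖ := norm_pos_iff.2 (sub_ne_zero.2 hzx)
  rw [← div_le_iff₀ hd]
  refine le_trans ?_ (h2 ⟨hd, hz⟩ : _ < _).le
  refine le_csSup (h.bddAbove_quotients hc hd x) ⟨‖z - x‖⁻¹ • (z - x), Or.inr ?_, ?_⟩
  · rw [norm_smul, norm_inv, norm_norm, inv_mul_cancel₀ hd.ne']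
  · simp only
    rw [smul_smul, mul_inv_cancel₀ hd.ne', one_smul, add_sub_cancel]

theorem IncrementBound.locLip_le {f : X → ℝ} {c p : ℝ} (h : IncrementBound f c p)
    (hc : 0 < c) (hp : 1 < p) {v : X → X} (hv : SteepestAscent f v) (x : X) :
    locLip f x ≤ c * (1 + ‖x‖) ^ (p - 1) := by
  have h1 : Tendsto (fun r : ℝ => c * ((1 + ‖x‖) ^ (p - 1) + r ^ (p - 1))) (𝓝[>] 0)
      (𝓝 (c * ((1 + ‖x‖) ^ (p - 1) + 0 ^ (p - 1)))) := by
    have := (Real.continuous_rpow_const (q := p - 1) (by linarith)).tendsto 0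
    exact ((this.mono_left nhdsWithin_le_nhds).const_add _).const_mul _
  rw [Real.zero_rpow (by linarith), add_zero] at h1
  refine le_of_tendsto_of_tendsto (hv.2 x).2 h1 ?_
  filter_upwards [self_mem_nhdsWithin] with r hr
  exact h.div_le hc hr (hv.2 x).1

theorem measurable_locLip {f : X → ℝ} (hf : Continuous f) {v : X → X}
    (hv : SteepestAscent f v) : Measurable (locLip f) := by
  have hu : Tendsto (fun n : ℕ => 1 / ((n : ℝ) + 1)) atTop (𝓝[>] 0) :=
    tendsto_nhdsWithin_iff.2 ⟨tendsto_one_div_add_atTop_nhds_zero_nat,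
      Eventually.of_forall fun n => by simp only [mem_Ioi]; positivity⟩
  refine measurable_of_tendsto_metrizable
    (f := fun (n : ℕ) x => (f (x + (1 / ((n : ℝ) + 1)) • v x) - f x) / (1 / ((n : ℝ) + 1)))
    (fun n => ?_) (tendsto_pi_nhds.2 fun x => (hv.2 x).2.comp hu)
  exact ((hf.measurable.comp (measurable_id.add (hv.1.const_smul _))).sub
    hf.measurable).div_const _

/-- The least `H ≥ 0` with `f z - f y ≤ H * ‖z - y‖ + n * ‖z - y‖ ^ p` for all `z`, computed along
a dense sequence. -/
def penalizedSlope (f : X → ℝ) (p n : ℝ) (y : X) : ℝ :=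
  ⨆ i : ℕ, max 0 ((f (TopologicalSpace.denseSeq X i) - f y) / ‖TopologicalSpace.denseSeq X i - y‖
    - n * ‖TopologicalSpace.denseSeq X i - y‖ ^ (p - 1))

theorem IncrementBound.penalizedSlope_term_le {f : X → ℝ} {c p : ℝ} (h : IncrementBound f c p)
    (hc : 0 < c) {n : ℝ} (hn : c ≤ n) (y z : X) :
    max 0 ((f z - f y) / ‖z - y‖ - n * ‖z - y‖ ^ (p - 1)) ≤ c * (1 + ‖y‖) ^ (p - 1) := by
  refine max_le (by positivity) ?_
  have h1 : (f z - f y) / ‖z - y‖ ≤ c * ((1 + ‖y‖) ^ (p - 1) + ‖z - y‖ ^ (p - 1)) :=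
    div_le_of_le_mul₀ (norm_nonneg _) (by positivity) ((le_abs_self _).trans (h y z))
  have := mul_le_mul_of_nonneg_right hn (Real.rpow_nonneg (norm_nonneg (z - y)) (p - 1))
  linarith

theorem IncrementBound.bddAbove_penalizedSlope {f : X → ℝ} {c p : ℝ} (h : IncrementBound f c p)
    (hc : 0 < c) {n : ℝ} (hn : c ≤ n) (y : X) :
    BddAbove (range fun i : ℕ =>
      max 0 ((f (TopologicalSpace.denseSeq X i) - f y) / ‖TopologicalSpace.denseSeq X i - y‖
        - n * ‖TopologicalSpace.denseSeq X i - y‖ ^ (p - 1))) := by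
  refine ⟨c * (1 + ‖y‖) ^ (p - 1), ?_⟩
  rintro _ ⟨i, rfl⟩
  exact h.penalizedSlope_term_le hc hn y _

theorem IncrementBound.penalizedSlope_le {f : X → ℝ} {c p : ℝ} (h : IncrementBound f c p)
    (hc : 0 < c) {n : ℝ} (hn : c ≤ n) (y : X) :
    penalizedSlope f p n y ≤ c * (1 + ‖y‖) ^ (p - 1) :=
  ciSup_le fun _ => h.penalizedSlope_term_le hc hn y _

theorem penalizedSlope_nonneg (f : X → ℝ) (p n : ℝ) (y : X) : 0 ≤ penalizedSlope f p n y :=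
  Real.iSup_nonneg fun _ => le_max_left _ _

theorem measurable_penalizedSlope {f : X → ℝ} (hf : Continuous f) (p n : ℝ) :
    Measurable (penalizedSlope f p n) := by
  have := hf.measurable
  unfold penalizedSlope
  refine Measurable.iSup fun i => measurable_const.max ?_
  fun_prop

theorem IncrementBound.sub_le_penalizedSlope {f : X → ℝ} {c p : ℝ} (h : IncrementBound f c p)
    (hc : 0 < c) (hp : 1 < p) {n : ℝ} (hn : c ≤ n) (y z : X) :
    f z - f y ≤ penalizedSlope f p n y * ‖z - y‖ + n * ‖z - y‖ ^ p := by
  have hcont : Continuous fun z => penalizedSlope f p n y * ‖z - y‖ + n * ‖z - y‖ ^ p := by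
    have : Continuous fun z : X => ‖z - y‖ ^ p :=
      (by fun_prop : Continuous fun z : X => ‖z - y‖).rpow_const
        fun _ => Or.inr (by linarith)
    fun_prop
  have hclosed : IsClosed {z | f z - f y ≤
      penalizedSlope f p n y * ‖z - y‖ + n * ‖z - y‖ ^ p} :=
    isClosed_le ((h.continuous hp).sub continuous_const) hcont
  refine hclosed.closure_subset_iff.2 ?_
    ((TopologicalSpace.denseRange_denseSeq X).closure_range ▸ mem_univ z)
  rintro _ ⟨i, rfl⟩
  simp only [mem_ofPred_eq]
  have h1 := (le_max_right _ _).trans (le_ciSup (h.bddAbove_penalizedSlope hc hn y) i)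
  change _ ≤ penalizedSlope f p n y at h1
  generalize TopologicalSpace.denseSeq X i = w at *
  rcases eq_or_ne w y with rfl | hwy
  · simp [Real.zero_rpow (show p ≠ 0 by linarith)]
  have hd : 0 < ‖w - y‖ := norm_pos_iff.2 (sub_ne_zero.2 hwy)
  rw [sub_le_iff_le_add, div_le_iff₀ hd] at h1
  refine h1.trans_eq ?_
  rw [add_mul, mul_assoc, rpow_sub_one_mul_self hd.le hp]

theorem IncrementBound.tendsto_penalizedSlope {f : X → ℝ} {c p : ℝ} (h : IncrementBound f c p)
    (hc : 0 < c) (hp : 1 < p) {v : X → X} (hv : SteepestAscent f v) (y : X) :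
    Tendsto (fun n : ℕ => penalizedSlope f p (n + c) y) atTop (𝓝 (locLip f y)) := by
  have hlow : ∀ n : ℕ, locLip f y ≤ penalizedSlope f p (n + c) y := fun n => by
    have hnn : c ≤ n + c := by simp
    have h1 : Tendsto (fun r : ℝ => penalizedSlope f p (n + c) y + (n + c) * r ^ (p - 1)) (𝓝[>] 0)
        (𝓝 (penalizedSlope f p (n + c) y + (n + c) * 0 ^ (p - 1))) := by
      have := (Real.continuous_rpow_const (q := p - 1) (by linarith)).tendsto 0
      exact ((this.mono_left nhdsWithin_le_nhds).const_mul _).const_add _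
    rw [Real.zero_rpow (by linarith), mul_zero, add_zero] at h1
    refine le_of_tendsto_of_tendsto (hv.2 y).2 h1 ?_
    filter_upwards [self_mem_nhdsWithin] with r (hr : 0 < r)
    have h2 := h.sub_le_penalizedSlope hc hp hnn y (y + r • v y)
    have h3 := penalizedSlope_nonneg f p (n + c) y
    rw [div_le_iff₀ hr]
    rcases (hv.2 y).1 with hu | hu
    · rw [norm_eq_zero] at hu
      simp only [hu, smul_zero, add_zero, sub_self]
      positivity
    · rw [add_sub_cancel_left, norm_smul, hu, mul_one, Real.norm_of_nonneg hr.le] at h2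
      rwa [add_mul, mul_assoc, rpow_sub_one_mul_self hr.le hp]
  rw [tendsto_order]
  refine ⟨fun a ha => Eventually.of_forall fun n => ha.trans_le (hlow n), fun a ha => ?_⟩
  obtain ⟨ε, hε, hεa⟩ : ∃ ε > 0, locLip f y + ε < a :=
    ⟨(a - locLip f y) / 2, by linarith, by linarith⟩
  obtain ⟨r, hr, h1⟩ := h.exists_sub_le hc hp y hε
  have h2 : Tendsto (fun n : ℕ => (n : ℝ) * r ^ (p - 1)) atTop atTop :=
    tendsto_natCast_atTop_atTop.atTop_mul_const (by positivity)
  have hl := h.locLip_nonneg hc hp y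
  filter_upwards [h2.eventually_ge_atTop (c * (1 + ‖y‖) ^ (p - 1))] with n hn
  refine lt_of_le_of_lt (ciSup_le fun i => max_le (by linarith) ?_) hεa
  generalize TopologicalSpace.denseSeq X i = w
  have hw := Real.rpow_nonneg (norm_nonneg (w - y)) (p - 1)
  rcases lt_or_ge ‖w - y‖ r with hwr | hwr
  · have : (f w - f y) / ‖w - y‖ ≤ locLip f y + ε :=
      div_le_of_le_mul₀ (norm_nonneg _) (by linarith) (h1 w hwr)
    have : 0 ≤ (n + c) * ‖w - y‖ ^ (p - 1) := by positivity
    linarith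
  · have h3 : (f w - f y) / ‖w - y‖ ≤ c * ((1 + ‖y‖) ^ (p - 1) + ‖w - y‖ ^ (p - 1)) :=
      div_le_of_le_mul₀ (norm_nonneg _) (by positivity) ((le_abs_self _).trans (h y w))
    have h4 : (n : ℝ) * r ^ (p - 1) ≤ n * ‖w - y‖ ^ (p - 1) := by gcongr
    nlinarith

theorem IsCoupling.integral_sub_le {p q : ℝ} (hpq : p.HolderConjugate q) {μ ν : Measure X}
    {π : Measure (X × X)} (hπ : IsCoupling μ ν π) {f H : X → ℝ} {n D : ℝ}
    (hfμ : Integrable f μ) (hfν : Integrable f ν) (hHm : Measurable H) (hH0 : ∀ x, 0 ≤ H x)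
    (hH : Integrable (fun x => H x ^ q) μ) (hn : 0 ≤ n) (hD : 0 ≤ D)
    (hfH : ∀ y z, f z - f y ≤ H y * ‖z - y‖ + n * ‖z - y‖ ^ p)
    (hcost : ∫⁻ q, (‖q.1 - q.2‖₊ : ℝ≥0∞) ^ p ∂π ≤ ENNReal.ofReal (D ^ p)) :
    ∫ x, f x ∂ν - ∫ x, f x ∂μ ≤ (∫ x, H x ^ q ∂μ) ^ (1 / q) * D + n * D ^ p := by
  have hp0 := hpq.pos
  have hq0 := hpq.symm.pos
  obtain ⟨h1, h2⟩ := hπ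
  have hdm : Continuous fun w : X × X => ‖w.2 - w.1‖ := by fun_prop
  have hdpm : Continuous fun w : X × X => ‖w.2 - w.1‖ ^ p :=
    hdm.rpow_const fun _ => Or.inr hp0.le
  have hlint : ∫⁻ w, ENNReal.ofReal (‖w.2 - w.1‖ ^ p) ∂π ≤ ENNReal.ofReal (D ^ p) := by
    refine le_of_eq_of_le (lintegral_congr fun w => ?_) hcost
    rw [← ENNReal.ofReal_rpow_of_nonneg (norm_nonneg _) hp0.le, norm_sub_rev, ofReal_norm]
    rfl
  have hdp : Integrable (fun w : X × X => ‖w.2 - w.1‖ ^ p) π := by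
    refine ⟨hdpm.aestronglyMeasurable, ?_⟩
    rw [hasFiniteIntegral_iff_ofReal (ae_of_all _ fun w => by positivity)]
    exact hlint.trans_lt ENNReal.ofReal_lt_top
  have hdint : ∫ w, ‖w.2 - w.1‖ ^ p ∂π ≤ D ^ p := by
    rw [integral_eq_lintegral_of_nonneg_ae (ae_of_all _ fun w => by positivity)
      hdpm.aestronglyMeasurable]
    exact ENNReal.toReal_le_of_le_ofReal (by positivity) hlint
  have hHq : Integrable (fun w : X × X => H w.1 ^ q) π := by
    rw [← h1] at hH
    exact hH.comp_measurable measurable_fst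
  have hHint : ∫ w, H w.1 ^ q ∂π = ∫ x, H x ^ q ∂μ := by
    rw [← h1, integral_map measurable_fst.aemeasurable (hHm.pow_const q).aestronglyMeasurable]
  have hdL : MemLp (fun w : X × X => ‖w.2 - w.1‖) (ENNReal.ofReal p) π := by
    rw [← integrable_norm_rpow_iff hdm.aestronglyMeasurable (by simpa using hp0)
      ENNReal.ofReal_ne_top, ENNReal.toReal_ofReal hp0.le]
    simpa using hdp
  have hHL : MemLp (fun w : X × X => H w.1) (ENNReal.ofReal q) π := by
    have hHa : AEStronglyMeasurable (fun w : X × X => H w.1) π :=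
      (hHm.comp measurable_fst).aestronglyMeasurable
    rw [← integrable_norm_rpow_iff hHa
      (by simpa using hq0) ENNReal.ofReal_ne_top, ENNReal.toReal_ofReal hq0.le]
    simpa [abs_of_nonneg (hH0 _)] using hHq
  have hholder := integral_mul_le_Lp_mul_Lq_of_nonneg hpq.symm
    (ae_of_all π fun w => hH0 w.1) (ae_of_all π fun w => norm_nonneg (w.2 - w.1)) hHL hdL
  have hmulint : Integrable (fun w : X × X => H w.1 * ‖w.2 - w.1‖) π := by
    have : ENNReal.HolderConjugate (ENNReal.ofReal q) (ENNReal.ofReal p) := hpq.symm.ennrealOfReal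
    exact hHL.integrable_mul hdL
  have e1 : ∫ x, f x ∂μ = ∫ w, f w.1 ∂π := by
    have := hfμ.aestronglyMeasurable
    rw [← h1] at this ⊢
    rw [integral_map measurable_fst.aemeasurable this]
  have e2 : ∫ x, f x ∂ν = ∫ w, f w.2 ∂π := by
    have := hfν.aestronglyMeasurable
    rw [← h2] at this ⊢
    rw [integral_map measurable_snd.aemeasurable this]
  have i1 : Integrable (fun w : X × X => f w.1) π := by
    rw [← h1] at hfμ
    exact hfμ.comp_measurable measurable_fst
  have i2 : Integrable (fun w : X × X => f w.2) π := by
    rw [← h2] at hfν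
    exact hfν.comp_measurable measurable_snd
  rw [e1, e2, ← integral_sub i2 i1]
  calc ∫ w, f w.2 - f w.1 ∂π
      ≤ ∫ w, H w.1 * ‖w.2 - w.1‖ + n * ‖w.2 - w.1‖ ^ p ∂π :=
        integral_mono (i2.sub i1) (hmulint.add (hdp.const_mul n)) fun w => hfH w.1 w.2
    _ = ∫ w, H w.1 * ‖w.2 - w.1‖ ∂π + n * ∫ w, ‖w.2 - w.1‖ ^ p ∂π := by
        rw [integral_add hmulint (hdp.const_mul n), integral_const_mul]
    _ ≤ _ := by
        refine add_le_add (hholder.trans ?_) (mul_le_mul_of_nonneg_left hdint hn)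
        rw [hHint]
        refine mul_le_mul_of_nonneg_left ?_
          (Real.rpow_nonneg (integral_nonneg fun x => Real.rpow_nonneg (hH0 x) q) _)
        calc _ ≤ (D ^ p) ^ (1 / p) := Real.rpow_le_rpow
              (integral_nonneg fun w => by positivity) hdint (by positivity)
          _ = D := by rw [one_div, Real.rpow_rpow_inv hD hp0.ne']

theorem Wp_lt_top {p : ℝ} (hp : 1 < p) {μ ν : Measure X} (hμ : μ ∈ Pp (X := X) p)
    (hν : ν ∈ Pp (X := X) p) : Wp p μ ν < ⊤ := by
  have := hμ.1
  have := hν.1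
  refine ENNReal.rpow_lt_top_of_nonneg (by positivity) (ne_of_lt ?_)
  have hc : IsCoupling μ ν (μ.prod ν) := ⟨by simp, by simp⟩
  refine (iInf₂_le (μ.prod ν) hc).trans_lt ?_
  have hi : Integrable (fun w : X × X => 2 ^ p * (‖w.1‖ ^ p + ‖w.2‖ ^ p)) (μ.prod ν) :=
    (((integrable_norm_rpow hp hμ).comp_fst ν).add
      ((integrable_norm_rpow hp hν).comp_snd μ)).const_mul _
  refine lt_of_le_of_lt (lintegral_mono fun w => ?_)
    ((hasFiniteIntegral_iff_ofReal (ae_of_all _ fun w => by positivity)).1 hi.2)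
  calc (‖w.1 - w.2‖₊ : ℝ≥0∞) ^ p = ENNReal.ofReal (‖w.1 - w.2‖ ^ p) := by
        rw [← ENNReal.ofReal_rpow_of_nonneg (norm_nonneg _) (by linarith), ofReal_norm]
        rfl
    _ ≤ _ := ENNReal.ofReal_le_ofReal ((Real.rpow_le_rpow (norm_nonneg _) (norm_sub_le _ _)
        (by linarith)).trans (add_rpow_le_two_rpow_mul (norm_nonneg _) (norm_nonneg _)
        (by linarith)))

theorem integral_sub_le_Wp {p q : ℝ} (hpq : p.HolderConjugate q) {μ ν : Measure X}
    (hμ : μ ∈ Pp (X := X) p) (hν : ν ∈ Pp (X := X) p) {f H : X → ℝ} {n : ℝ}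
    (hfμ : Integrable f μ) (hfν : Integrable f ν) (hHm : Measurable H) (hH0 : ∀ x, 0 ≤ H x)
    (hH : Integrable (fun x => H x ^ q) μ) (hn : 0 ≤ n)
    (hfH : ∀ y z, f z - f y ≤ H y * ‖z - y‖ + n * ‖z - y‖ ^ p) :
    ∫ x, f x ∂ν - ∫ x, f x ∂μ ≤
      (∫ x, H x ^ q ∂μ) ^ (1 / q) * (Wp p μ ν).toReal + n * (Wp p μ ν).toReal ^ p := by
  have hp0 := hpq.pos
  have hW := Wp_lt_top hpq.lt hμ hν
  have hlim : Tendsto (fun D : ℝ => (∫ x, H x ^ q ∂μ) ^ (1 / q) * D + n * D ^ p)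
      (𝓝[>] (Wp p μ ν).toReal) (𝓝 ((∫ x, H x ^ q ∂μ) ^ (1 / q) * (Wp p μ ν).toReal
        + n * (Wp p μ ν).toReal ^ p)) := by
    have := Real.continuous_rpow_const (q := p) hp0.le
    exact ((by fun_prop : Continuous fun D : ℝ =>
      (∫ x, H x ^ q ∂μ) ^ (1 / q) * D + n * D ^ p).tendsto _).mono_left nhdsWithin_le_nhds
  refine ge_of_tendsto hlim ?_
  filter_upwards [self_mem_nhdsWithin] with D (hD : _ < D)
  have hD0 : 0 < D := ENNReal.toReal_nonneg.trans_lt hD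
  rw [← ENNReal.lt_ofReal_iff_toReal_lt hW.ne, Wp, one_div,
    ENNReal.rpow_inv_lt_iff hp0, ENNReal.ofReal_rpow_of_nonneg hD0.le hp0.le] at hD
  obtain ⟨π, hπ, hcost⟩ := by simpa only [iInf_lt_iff] using hD
  exact IsCoupling.integral_sub_le hpq hπ hfμ hfν hHm hH0 hH hn hD0.le hfH hcost.le

theorem rpow_sub_one_rpow {p q : ℝ} (hpq : p.HolderConjugate q) {t : ℝ} (ht : 0 ≤ t) :
    (t ^ (p - 1)) ^ q = t ^ p := by
  rw [← Real.rpow_mul ht, hpq.sub_one_mul_conj]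

theorem integrable_rpow_of_le {p q : ℝ} (hpq : p.HolderConjugate q) {μ : Measure X}
    (hμ : μ ∈ Pp (X := X) p) {c : ℝ} {H : X → ℝ} (hHm : Measurable H)
    (hH0 : ∀ x, 0 ≤ H x) (hc : 0 ≤ c) (hH : ∀ x, H x ≤ c * (1 + ‖x‖) ^ (p - 1)) :
    Integrable (fun x => H x ^ q) μ := by
  refine ((integrable_one_add_norm_rpow hpq.lt hμ).const_mul (c ^ q)).mono'
    (hHm.pow_const q).aestronglyMeasurable (ae_of_all _ fun x => ?_)
  rw [Real.norm_of_nonneg (Real.rpow_nonneg (hH0 x) q), ← rpow_sub_one_rpow hpq (by positivity),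
    ← Real.mul_rpow hc (by positivity)]
  exact Real.rpow_le_rpow (hH0 x) (hH x) hpq.symm.pos.le

theorem IncrementBound.tendsto_Lq_penalizedSlope {f : X → ℝ} {c p q : ℝ}
    (h : IncrementBound f c p) (hc : 0 < c) (hpq : p.HolderConjugate q) {μ : Measure X}
    (hμ : μ ∈ Pp (X := X) p) {v : X → X} (hv : SteepestAscent f v) :
    Tendsto (fun n : ℕ => (∫ x, penalizedSlope f p (n + c) x ^ q ∂μ) ^ (1 / q)) atTop
      (𝓝 ((∫ x, locLip f x ^ q ∂μ) ^ (1 / q))) := by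
  have hq0 := hpq.symm.pos
  have hcont := h.continuous hpq.lt
  refine ((Real.continuous_rpow_const (q := 1 / q) (by positivity)).tendsto _).comp ?_
  refine tendsto_integral_of_dominated_convergence (fun x => c ^ q * (1 + ‖x‖) ^ p)
    (fun n => ((measurable_penalizedSlope hcont p _).pow_const q).aestronglyMeasurable)
    ((integrable_one_add_norm_rpow hpq.lt hμ).const_mul _) (fun n => ae_of_all _ fun x => ?_)
    (ae_of_all _ fun x => ?_)
  · have h0 := penalizedSlope_nonneg f p (n + c) x
    rw [Real.norm_of_nonneg (Real.rpow_nonneg h0 q), ← rpow_sub_one_rpow hpq (by positivity),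
      ← Real.mul_rpow hc.le (by positivity)]
    exact Real.rpow_le_rpow h0 (h.penalizedSlope_le hc (by simp) x) hq0.le
  · exact ((Real.continuous_rpow_const hq0.le).tendsto _).comp
      (h.tendsto_penalizedSlope hc hpq.lt hv x)

theorem exists_dual_weight {p q : ℝ} (hpq : p.HolderConjugate q) {μ : Measure X} {g : X → ℝ}
    (hgm : Measurable g) (hg0 : ∀ x, 0 ≤ g x) (hg : Integrable (fun x => g x ^ q) μ) :
    ∃ w : X → ℝ, Measurable w ∧ (∀ x, 0 ≤ w x) ∧ Integrable (fun x => w x ^ p) μ ∧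
      ∫ x, w x ^ p ∂μ ≤ 1 ∧ ∫ x, w x * g x ∂μ = (∫ x, g x ^ q ∂μ) ^ (1 / q) := by
  have hp0 := hpq.pos
  have hq0 := hpq.symm.pos
  set A := ∫ x, g x ^ q ∂μ with hA
  have hA0 : 0 ≤ A := integral_nonneg fun x => Real.rpow_nonneg (hg0 x) q
  rcases hA0.eq_or_lt with hA' | hApos
  · refine ⟨0, measurable_zero, fun _ => le_rfl, ?_, ?_, ?_⟩
    · simp [Real.zero_rpow hp0.ne']
    · simp [Real.zero_rpow hp0.ne']
    · rw [← hA', Real.zero_rpow (by positivity)]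
      simp
  have hwp : ∀ x, (g x ^ (q - 1) * A ^ (-(1 / p))) ^ p = g x ^ q * A⁻¹ := fun x => by
    rw [Real.mul_rpow (Real.rpow_nonneg (hg0 x) _) (by positivity),
      rpow_sub_one_rpow hpq.symm (hg0 x), ← Real.rpow_mul hA0, neg_mul,
      one_div_mul_cancel hp0.ne', Real.rpow_neg_one]
  refine ⟨fun x => g x ^ (q - 1) * A ^ (-(1 / p)), (hgm.pow_const _).mul_const _,
    fun x => mul_nonneg (Real.rpow_nonneg (hg0 x) _) (by positivity), ?_, ?_, ?_⟩
  · simp_rw [hwp]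
    exact hg.mul_const _
  · simp_rw [hwp]
    rw [integral_mul_const, mul_inv_cancel₀ hApos.ne']
  · have : ∀ x, g x ^ (q - 1) * A ^ (-(1 / p)) * g x = g x ^ q * A ^ (-(1 / p)) := fun x => by
      rw [mul_right_comm, rpow_sub_one_mul_self (hg0 x) hpq.symm.lt]
    simp_rw [this]
    rw [integral_mul_const, ← hA]
    nth_rw 1 [← Real.rpow_one A]
    rw [← Real.rpow_add hApos]
    congr 1
    have := hpq.inv_add_inv_eq_one
    rw [one_div, one_div]
    linarith

theorem IncrementBound.exists_transport {f : X → ℝ} {c p q : ℝ}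
    (hf : IncrementBound f c p) (hc : 0 < c) (hpq : p.HolderConjugate q) {μ : Measure X}
    (hμ : μ ∈ Pp (X := X) p) {v : X → X} (hv : SteepestAscent f v) {t : ℝ} (ht : 0 ≤ t) :
    ∃ ν : ℝ → Measure X, (∀ h > 0, ν h ∈ Pp (X := X) p ∧ Wp p μ (ν h) ≤ ENNReal.ofReal (h * t)) ∧
      Tendsto (fun h => (∫ x, f x ∂(ν h) - ∫ x, f x ∂μ) / h) (𝓝[>] 0)
        (𝓝 ((∫ x, locLip f x ^ q ∂μ) ^ (1 / q) * t)) := by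
  have hp0 := hpq.pos
  have hp := hpq.lt
  have hcont := hf.continuous hp
  have := hμ.1
  have hgm := measurable_locLip hcont hv
  have hg0 := hf.locLip_nonneg hc hp
  obtain ⟨w, hwm, hw0, hwi, hw1, hwg⟩ := exists_dual_weight hpq hgm hg0
    (integrable_rpow_of_le hpq hμ hgm hg0 hc.le (hf.locLip_le hc hp hv))
  have hvn : ∀ x, ‖v x‖ ≤ 1 := fun x => by
    rcases (hv.2 x).1 with h | h <;> rw [h]
    exact zero_le_one
  have hvm := hv.1
  have hTm : ∀ h : ℝ, Measurable fun x => x + (h * (t * w x)) • v x := fun h => by fun_prop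
  have hstep : ∀ h : ℝ, 0 ≤ h → ∀ x, ‖(h * (t * w x)) • v x‖ ≤ h * t * w x := fun h hh x => by
    have : 0 ≤ h * (t * w x) := mul_nonneg hh (mul_nonneg ht (hw0 x))
    rw [norm_smul, Real.norm_of_nonneg this, mul_assoc h t]
    exact mul_le_of_le_one_right this (hvn x)
  have hstepi : ∀ h : ℝ, 0 ≤ h → Integrable (fun x => (h * t * w x) ^ p) μ := fun h hh => by
    simp_rw [fun x => Real.mul_rpow (z := p) (mul_nonneg hh ht) (hw0 x)]
    exact hwi.const_mul _
  have hmem : ∀ h > 0, μ.map (fun x => x + (h * (t * w x)) • v x) ∈ Pp (X := X) p := fun h hh => by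
    refine ⟨Measure.isProbabilityMeasure_map (hTm h).aemeasurable, ?_⟩
    rw [lintegral_map (by fun_prop) (hTm h)]
    have hi := ((integrable_norm_rpow hp hμ).add (hstepi h hh.le)).const_mul (2 ^ p)
    refine lt_of_le_of_lt (lintegral_mono fun x => ?_) ((hasFiniteIntegral_iff_ofReal
      (ae_of_all _ fun x => ?_)).1 hi.2)
    · rw [← ENNReal.ofReal_coe_nnreal, coe_nnnorm, ENNReal.ofReal_rpow_of_nonneg
        (norm_nonneg _) hp0.le]
      refine ENNReal.ofReal_le_ofReal ?_
      have h1 : 0 ≤ h * t * w x := mul_nonneg (mul_nonneg hh.le ht) (hw0 x)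
      exact (Real.rpow_le_rpow (norm_nonneg _) ((norm_add_le _ _).trans
        (add_le_add_right (hstep h hh.le x) _)) hp0.le).trans
        (add_rpow_le_two_rpow_mul (norm_nonneg _) h1 hp0.le)
    · have h1 : 0 ≤ h * t * w x := mul_nonneg (mul_nonneg hh.le ht) (hw0 x)
      simp only [Pi.add_apply, Pi.zero_apply]
      positivity
  refine ⟨fun h => μ.map fun x => x + (h * (t * w x)) • v x, fun h hh => ⟨hmem h hh, ?_⟩, ?_⟩
  · have hht : 0 ≤ h * t := mul_nonneg hh.le ht
    rw [Wp, one_div, ENNReal.rpow_inv_le_iff hp0, ENNReal.ofReal_rpow_of_nonneg hht hp0.le]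
    have hpm : Measurable fun x => (x, x + (h * (t * w x)) • v x) := measurable_id.prodMk (hTm h)
    have hπ : IsCoupling μ (μ.map fun x => x + (h * (t * w x)) • v x)
        (μ.map fun x => (x, x + (h * (t * w x)) • v x)) :=
      ⟨by rw [Measure.map_map measurable_fst hpm]; exact Measure.map_id,
        by rw [Measure.map_map measurable_snd hpm]; rfl⟩
    refine (iInf₂_le _ hπ).trans ?_
    rw [lintegral_map (by fun_prop) hpm]
    calc ∫⁻ x, (‖x - (x + (h * (t * w x)) • v x)‖₊ : ℝ≥0∞) ^ p ∂μ
        ≤ ∫⁻ x, ENNReal.ofReal ((h * t * w x) ^ p) ∂μ := lintegral_mono fun x => by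
          rw [← ENNReal.ofReal_coe_nnreal, coe_nnnorm, ENNReal.ofReal_rpow_of_nonneg
            (norm_nonneg _) hp0.le, sub_add_cancel_left, norm_neg]
          exact ENNReal.ofReal_le_ofReal
            (Real.rpow_le_rpow (norm_nonneg _) (hstep h hh.le x) hp0.le)
      _ = ENNReal.ofReal (∫ x, (h * t * w x) ^ p ∂μ) :=
          (ofReal_integral_eq_lintegral_ofReal (hstepi h hh.le)
            (ae_of_all _ fun x => Real.rpow_nonneg (mul_nonneg hht (hw0 x)) p)).symm
      _ ≤ ENNReal.ofReal ((h * t) ^ p) := by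
          refine ENNReal.ofReal_le_ofReal ?_
          simp_rw [fun x => Real.mul_rpow (z := p) hht (hw0 x)]
          rw [integral_const_mul]
          exact mul_le_of_le_one_right (by positivity) hw1
  · rw [← hwg, mul_comm, ← integral_const_mul]
    have hfμ := hf.integrable hp hc hμ
    have hlim : Tendsto (fun h : ℝ => ∫ x, (f (x + (h * (t * w x)) • v x) - f x) / h ∂μ) (𝓝[>] 0)
        (𝓝 (∫ x, t * (w x * locLip f x) ∂μ)) := by
      refine tendsto_integral_filter_of_dominated_convergence
        (fun x => c * ((1 + ‖x‖) ^ p + (t * w x) ^ p + (t * w x) ^ p)) ?_ ?_ ?_ ?_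
      · exact Eventually.of_forall fun h => (((hcont.measurable.comp (hTm h)).sub
          hcont.measurable).div_const h).aestronglyMeasurable
      · filter_upwards [Ioo_mem_nhdsGT zero_lt_one] with h hh
        refine ae_of_all _ fun x => ?_
        have htw : 0 ≤ t * w x := mul_nonneg ht (hw0 x)
        have h1 := hf x (x + (h * (t * w x)) • v x)
        rw [add_sub_cancel_left] at h1
        have h2 := hstep h hh.1.le x
        rw [mul_assoc] at h2
        have h3 : ‖(h * (t * w x)) • v x‖ ≤ t * w x :=
          h2.trans (mul_le_of_le_one_left htw hh.2.le)
        have h4 : ‖(h * (t * w x)) • v x‖ ^ (p - 1) ≤ (t * w x) ^ (p - 1) :=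
          Real.rpow_le_rpow (norm_nonneg _) h3 (by linarith)
        have h5 := rpow_sub_one_mul_le (a := 1 + ‖x‖) (by positivity) htw hp
        have h6 := rpow_sub_one_mul_self htw hp
        rw [norm_div, Real.norm_eq_abs, Real.norm_of_nonneg hh.1.le, div_le_iff₀ hh.1]
        calc _ ≤ c * ((1 + ‖x‖) ^ (p - 1) + (t * w x) ^ (p - 1)) * (h * (t * w x)) := by
              refine h1.trans ?_
              gcongr
          _ = c * ((1 + ‖x‖) ^ (p - 1) * (t * w x) + (t * w x) ^ (p - 1) * (t * w x)) * h := by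
              ring
          _ ≤ _ := by
              rw [h6]
              have := hh.1.le
              gcongr
      · have := hstepi 1 zero_le_one
        simp only [one_mul] at this
        exact (((integrable_one_add_norm_rpow hp hμ).add this).add this).const_mul c
      · refine ae_of_all _ fun x => ?_
        have htw : 0 ≤ t * w x := mul_nonneg ht (hw0 x)
        rw [← mul_assoc]
        rcases htw.eq_or_lt with h0 | hpos
        · simp [← h0]
        have hsub : Tendsto (fun h : ℝ => h * (t * w x)) (𝓝[>] 0) (𝓝[>] 0) := by
          refine tendsto_nhdsWithin_iff.2 ⟨?_, ?_⟩
          · have : Tendsto (fun h : ℝ => h * (t * w x)) (𝓝 0) (𝓝 (0 * (t * w x))) :=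
              (continuous_id.mul continuous_const).tendsto 0
            rw [zero_mul] at this
            exact this.mono_left nhdsWithin_le_nhds
          · filter_upwards [self_mem_nhdsWithin] with h hh using mul_pos hh hpos
        refine (((hv.2 x).2.comp hsub).const_mul (t * w x)).congr' ?_
        filter_upwards [self_mem_nhdsWithin] with h (hh : 0 < h)
        simp only [Function.comp_apply]
        rw [mul_div_assoc', mul_comm h, mul_div_mul_left _ _ hpos.ne']
    refine hlim.congr' ?_
    filter_upwards [self_mem_nhdsWithin] with h (hh : 0 < h)
    have hfh : Integrable (fun x => f (x + (h * (t * w x)) • v x)) μ :=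
      (hf.integrable hp hc (hmem h hh)).comp_measurable (hTm h)
    rw [integral_map (hTm h).aemeasurable hcont.aestronglyMeasurable, integral_div,
      integral_sub hfh hfμ]

theorem exists_eventually_mul_rpow_le {φ : ℝ → ℝ≥0∞} {p : ℝ}
    (hgrowth : 0 < liminf (fun v : ℝ => φ v / ENNReal.ofReal (v ^ p)) atTop) :
    ∃ k : ℝ, 0 < k ∧ ∀ᶠ w in atTop, φ w ≠ ⊤ → k * w ^ p ≤ (φ w).toReal := by
  obtain ⟨k, hk0, hk⟩ := ENNReal.lt_iff_exists_nnreal_btwn.1 hgrowth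
  refine ⟨k, by simpa using hk0, ?_⟩
  filter_upwards [eventually_lt_of_lt_liminf hk, eventually_gt_atTop 0] with w hw hw0 hφ
  have h1 := (ENNReal.le_div_iff_mul_le (Or.inl (by simpa using Real.rpow_pos_of_pos hw0 p))
    (Or.inl ENNReal.ofReal_ne_top)).1 hw.le
  have h2 := ENNReal.toReal_mono hφ h1
  rwa [ENNReal.toReal_mul, ENNReal.coe_toReal,
    ENNReal.toReal_ofReal (Real.rpow_nonneg hw0.le p)] at h2

/-- A bound `u * w - φ w ≤ s` survives small perturbations of `u` and a small multiple of `w ^ p`,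
because `φ` grows at least like `w ^ p`. -/
theorem exists_perturbed_conjugate_bound {φ : ℝ → ℝ≥0∞} {p u s ε : ℝ} (hp : 1 < p)
    (hgrowth : 0 < liminf (fun v : ℝ => φ v / ENNReal.ofReal (v ^ p)) atTop)
    (hs0 : 0 ≤ s) (hε : 0 < ε)
    (hs : ∀ w, 0 ≤ w → φ w ≠ ⊤ → u * w - (φ w).toReal ≤ s) :
    ∃ δ > 0, ∀ a ≤ u + δ, ∀ b ≤ δ, ∀ w, 0 ≤ w → φ w ≠ ⊤ →
      a * w + b * w ^ p - (φ w).toReal ≤ s + ε := by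
  obtain ⟨k, hk, hev⟩ := exists_eventually_mul_rpow_le hgrowth
  have hev2 : ∀ᶠ w : ℝ in atTop, u + 1 ≤ (k / 2) * w ^ (p - 1) :=
    ((tendsto_rpow_atTop (by linarith)).const_mul_atTop (by positivity)).eventually_ge_atTop _
  obtain ⟨T, hT⟩ := eventually_atTop.1 ((hev.and hev2).and (eventually_ge_atTop 0))
  have hT0 : 0 ≤ T := (hT T le_rfl).2
  have hTp : 0 ≤ T ^ p := Real.rpow_nonneg hT0 p
  refine ⟨min (min 1 (k / 2)) (ε / (T + T ^ p + 1)), by positivity,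
    fun a ha b hb w hw hφ => ?_⟩
  set δ := min (min 1 (k / 2)) (ε / (T + T ^ p + 1))
  have hδ1 : δ ≤ 1 := (min_le_left _ _).trans (min_le_left _ _)
  have hδk : δ ≤ k / 2 := (min_le_left _ _).trans (min_le_right _ _)
  have hδ0 : 0 < δ := by positivity
  have hδε : δ * (T + T ^ p + 1) ≤ ε := (le_div_iff₀ (by positivity)).1 (min_le_right _ _)
  have hwp : 0 ≤ w ^ p := Real.rpow_nonneg hw p
  have h1 : a * w ≤ (u + δ) * w := mul_le_mul_of_nonneg_right ha hw
  have h2 : b * w ^ p ≤ δ * w ^ p := mul_le_mul_of_nonneg_right hb hwp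
  rcases le_total w T with h | h
  · have h3 := hs w hw hφ
    have h4 : w ^ p ≤ T ^ p := Real.rpow_le_rpow hw h (by linarith)
    have h5 : δ * w ≤ δ * T := mul_le_mul_of_nonneg_left h hδ0.le
    have h6 : δ * w ^ p ≤ δ * T ^ p := mul_le_mul_of_nonneg_left h4 hδ0.le
    linarith
  · obtain ⟨⟨h3, h4⟩, -⟩ := hT w h
    have h5 := mul_le_mul_of_nonneg_right h4 hw
    rw [mul_assoc, rpow_sub_one_mul_self hw hp] at h5
    have h6 : δ * w ^ p ≤ k / 2 * w ^ p := mul_le_mul_of_nonneg_right hδk hwp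
    have h7 : δ * w ≤ 1 * w := mul_le_mul_of_nonneg_right hδ1 hw
    linarith [h3 hφ]

theorem coe_sub_ennreal_toReal (x : ℝ) {y : ℝ≥0∞} (hy : y ≠ ⊤) :
    (x : EReal) - (y : EReal) = ((x - y.toReal : ℝ) : EReal) := by
  rw [EReal.coe_sub, EReal.coe_ennreal_toReal hy]

theorem le_inv_mul_sub {h m r : ℝ} {I : EReal} (hh : 0 < h) (hI : ((m + h * r : ℝ) : EReal) ≤ I) :
    (r : EReal) ≤ ((h⁻¹ : ℝ) : EReal) * (I - (m : EReal)) := by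
  have h1 : (r : EReal) = ((h⁻¹ : ℝ) : EReal) * (((m + h * r : ℝ) : EReal) - (m : EReal)) := by
    rw [← EReal.coe_sub, ← EReal.coe_mul, add_sub_cancel_left, inv_mul_cancel_left₀ hh.ne']
  rw [h1]
  exact mul_le_mul_of_nonneg_left (EReal.sub_le_sub hI le_rfl)
    (EReal.coe_nonneg.2 (inv_nonneg.2 hh.le))

theorem inv_mul_sub_le {h m r : ℝ} {I : EReal} (hh : 0 < h) (hI : I ≤ ((m + h * r : ℝ) : EReal)) :
    ((h⁻¹ : ℝ) : EReal) * (I - (m : EReal)) ≤ (r : EReal) := by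
  have h1 : (r : EReal) = ((h⁻¹ : ℝ) : EReal) * (((m + h * r : ℝ) : EReal) - (m : EReal)) := by
    rw [← EReal.coe_sub, ← EReal.coe_mul, add_sub_cancel_left, inv_mul_cancel_left₀ hh.ne']
  rw [h1]
  exact mul_le_mul_of_nonneg_left (EReal.sub_le_sub hI le_rfl)
    (EReal.coe_nonneg.2 (inv_nonneg.2 hh.le))

theorem IncrementBound.eventually_lt_Ifun {f : X → ℝ} {c p q : ℝ}
    (hf : IncrementBound f c p) (hc : 0 < c) (hpq : p.HolderConjugate q) {μ : Measure X}
    (hμ : μ ∈ Pp (X := X) p) {φ : ℝ → ℝ≥0∞} (hmono : MonotoneOn φ (Ici (0 : ℝ)))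
    {v : X → X} (hv : SteepestAscent f v) {a : EReal}
    (ha : a < phiStar φ ((∫ x, locLip f x ^ q ∂μ) ^ (1 / q))) :
    ∀ᶠ h : ℝ in 𝓝[>] 0,
      a < ((h⁻¹ : ℝ) : EReal) * (Ifun μ φ p h f - ((∫ x, f x ∂μ : ℝ) : EReal)) := by
  obtain ⟨t, ht, hat⟩ : ∃ t, 0 ≤ t ∧
      a < (((∫ x, locLip f x ^ q ∂μ) ^ (1 / q) * t : ℝ) : EReal) - ((φ t : ℝ≥0∞) : EReal) := by
    simpa only [phiStar, lt_iSup_iff, mem_Ici, exists_prop] using ha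
  have hφ : φ t ≠ ⊤ := fun h => by
    rw [h, EReal.coe_ennreal_top, EReal.sub_top] at hat
    exact not_lt_bot hat
  rw [coe_sub_ennreal_toReal _ hφ] at hat
  obtain ⟨ν, hν, hlim⟩ := hf.exists_transport hc hpq hμ hv ht
  have hlim' := (continuous_coe_real_ereal.tendsto _).comp (hlim.sub_const (φ t).toReal)
  filter_upwards [hlim'.eventually_const_lt hat, self_mem_nhdsWithin] with h h1 (hh : 0 < h)
  refine h1.trans_le (le_inv_mul_sub hh ?_)
  refine le_trans ?_ (le_iSup₂ (ν h) (hν h hh).1)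
  have hle : phih φ h (Wp p μ (ν h)).toReal ≤ ENNReal.ofReal h * φ t := by
    refine mul_le_mul_right (hmono (mem_Ici.2 (by positivity)) (mem_Ici.2 ht) ?_) _
    rw [div_le_iff₀ hh, mul_comm]
    exact ENNReal.toReal_le_of_le_ofReal (by positivity) (hν h hh).2
  have hfin : ENNReal.ofReal h * φ t ≠ ⊤ := ENNReal.mul_ne_top ENNReal.ofReal_ne_top hφ
  rw [coe_sub_ennreal_toReal _ (ne_top_of_le_ne_top hfin hle), EReal.coe_le_coe_iff]
  have h2 := ENNReal.toReal_mono hfin hle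
  rw [ENNReal.toReal_mul, ENNReal.toReal_ofReal hh.le] at h2
  rw [mul_sub, mul_div_cancel₀ _ hh.ne']
  linarith

theorem IncrementBound.eventually_Ifun_lt {f : X → ℝ} {c p q : ℝ}
    (hf : IncrementBound f c p) (hc : 0 < c) (hpq : p.HolderConjugate q) {μ : Measure X}
    (hμ : μ ∈ Pp (X := X) p) {φ : ℝ → ℝ≥0∞} (hzero : φ 0 = 0)
    (hgrowth : 0 < liminf (fun v : ℝ => φ v / ENNReal.ofReal (v ^ p)) atTop)
    {v : X → X} (hv : SteepestAscent f v) {b : EReal}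
    (hb : phiStar φ ((∫ x, locLip f x ^ q ∂μ) ^ (1 / q)) < b) :
    ∀ᶠ h : ℝ in 𝓝[>] 0,
      ((h⁻¹ : ℝ) : EReal) * (Ifun μ φ p h f - ((∫ x, f x ∂μ : ℝ) : EReal)) < b := by
  have hp := hpq.lt
  set u := (∫ x, locLip f x ^ q ∂μ) ^ (1 / q)
  have hconj : ∀ w, 0 ≤ w → φ w ≠ ⊤ → ((u * w - (φ w).toReal : ℝ) : EReal) ≤ phiStar φ u :=
    fun w hw hφ => by
      rw [← coe_sub_ennreal_toReal _ hφ]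
      exact le_iSup₂ (f := fun v (_ : v ∈ Ici (0 : ℝ)) =>
        ((u * v : ℝ) : EReal) - ((φ v : ℝ≥0∞) : EReal)) w hw
  have hstar0 : 0 ≤ phiStar φ u := by simpa [hzero] using hconj 0 le_rfl (by simp [hzero])
  obtain ⟨s', hs', hs'b⟩ := EReal.lt_iff_exists_real_btwn.1 hb
  obtain ⟨s, hs⟩ : ∃ s : ℝ, (s : EReal) = phiStar φ u :=
    ⟨_, EReal.coe_toReal (hs'.trans_le le_top).ne
      (lt_of_lt_of_le (EReal.bot_lt_coe 0) hstar0).ne'⟩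
  rw [← hs] at hs' hconj hstar0
  rw [EReal.coe_lt_coe_iff] at hs'
  obtain ⟨δ, hδ, hbound⟩ := exists_perturbed_conjugate_bound hp hgrowth
    (EReal.coe_nonneg.1 hstar0) (sub_pos.2 hs')
    fun w hw hφ => EReal.coe_le_coe_iff.1 (hconj w hw hφ)
  obtain ⟨n, hn⟩ := ((hf.tendsto_Lq_penalizedSlope hc hpq hμ hv).eventually_lt_const
    (show u < u + δ by linarith)).exists
  set H := penalizedSlope f p (n + c)
  have hnc : c ≤ n + c := by simp
  have hHm : Measurable H := measurable_penalizedSlope (hf.continuous hp) p _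
  have hH0 : ∀ x, 0 ≤ H x := penalizedSlope_nonneg f p _
  have hHi := integrable_rpow_of_le hpq hμ hHm hH0 hc.le (hf.penalizedSlope_le hc hnc)
  have hsmall : ∀ᶠ h : ℝ in 𝓝[>] 0, (n + c) * h ^ (p - 1) < δ := by
    have h1 : Tendsto (fun h : ℝ => (n + c) * h ^ (p - 1)) (𝓝 0) (𝓝 ((n + c) * 0 ^ (p - 1))) :=
      ((Real.continuous_rpow_const (q := p - 1) (by linarith)).tendsto 0).const_mul _
    rw [Real.zero_rpow (by linarith), mul_zero] at h1
    exact (h1.mono_left nhdsWithin_le_nhds).eventually_lt_const hδ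
  filter_upwards [hsmall, self_mem_nhdsWithin] with h h1 (hh : 0 < h)
  refine lt_of_le_of_lt (inv_mul_sub_le hh (iSup₂_le fun ν hν => ?_)) hs'b
  set W := (Wp p μ ν).toReal with hW
  have hW0 : 0 ≤ W := ENNReal.toReal_nonneg
  have hw0 : 0 ≤ W / h := div_nonneg hW0 hh.le
  by_cases hφ : φ (W / h) = ⊤
  · rw [phih, hφ, ENNReal.mul_top (by simpa using hh), EReal.coe_ennreal_top, EReal.sub_top]
    exact bot_le
  rw [phih, coe_sub_ennreal_toReal _ (ENNReal.mul_ne_top ENNReal.ofReal_ne_top hφ),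
    ENNReal.toReal_mul, ENNReal.toReal_ofReal hh.le, EReal.coe_le_coe_iff]
  have h2 := hbound _ hn.le _ h1.le _ hw0 hφ
  have h3 := integral_sub_le_Wp hpq hμ hν (hf.integrable hp hc hμ) (hf.integrable hp hc hν)
    hHm hH0 hHi (by positivity) (hf.sub_le_penalizedSlope hc hp hnc)
  have h4 : W ^ p = h * (h ^ (p - 1) * (W / h) ^ p) := by
    rw [← mul_assoc, mul_comm h, rpow_sub_one_mul_self hh.le hp, ← Real.mul_rpow hh.le hw0,
      mul_div_cancel₀ _ hh.ne']
  have h5 : W = h * (W / h) := (mul_div_cancel₀ _ hh.ne').symm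
  rw [← hW, h4] at h3
  nth_rw 1 [h5] at h3
  have h6 := mul_le_mul_of_nonneg_left h2 hh.le
  rw [add_sub_cancel] at h6
  linarith

theorem stmt1 (p q : ℝ) (hp : 1 < p) (hq : q = p / (p - 1))
    (μ : Measure X) (hμ : μ ∈ Pp (X := X) p)
    (φ : ℝ → ℝ≥0∞) (hmono : MonotoneOn φ (Ici (0 : ℝ))) (hzero : φ 0 = 0)
    (hgrowth : 0 < liminf (fun v : ℝ => φ v / ENNReal.ofReal (v ^ p)) atTop)
    (f : X → ℝ) (hf : MemLipP p f) (v : X → X) (hv : SteepestAscent f v) :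
    Tendsto (fun h : ℝ =>
        ((h⁻¹ : ℝ) : EReal) * (Ifun μ φ p h f - ((∫ x, f x ∂μ : ℝ) : EReal)))
      (𝓝[>] (0 : ℝ)) (𝓝 (phiStar φ ((∫ x, locLip f x ^ q ∂μ) ^ (1 / q)))) := by
  obtain ⟨c, hc, h⟩ := hf.exists_incrementBound hp
  have hpq : p.HolderConjugate q := (Real.holderConjugate_iff_eq_conjExponent hp).2 hq
  rw [tendsto_order]
  exact ⟨fun a ha => h.eventually_lt_Ifun hc hpq hμ hmono hv ha,
    fun b hb => h.eventually_Ifun_lt hc hpq hμ hzero hgrowth hv hb⟩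
end
end

section
/- Let p = 2 and f ∈ C¹_p. Define θ(x) := ∇f(x) − ∫_X ∇f(y) μ(dy) and Θ := {bθ : b ≥ 0}. Then lim_{h↓0} (I^Mean(h)f − I_Θ(h)f)/h = 0. -/
open MeasureTheory Filter Set
open scoped Topology ENNReal NNReal RealInnerProductSpace

noncomputable section

variable {X : Type*} [NormedAddCommGroup X] [InnerProductSpace ℝ X]
  [SecondCountableTopology X] [CompleteSpace X] [MeasurableSpace X] [BorelSpace X]

/-- Membership in `C¹_p`: continuously Fréchet differentiable with gradient growing
at most like `C(1+‖x‖)^{p-1}`. -/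
def MemC1p (p : ℝ) (f : X → ℝ) : Prop :=
  ContDiff ℝ 1 f ∧ ∃ C : ℝ, 0 ≤ C ∧ ∀ x : X, ‖gradient f x‖ ≤ C * (1 + ‖x‖) ^ (p - 1)

/-- Measures in `P_p` with the same (Bochner) barycenter as `μ`. -/
def PpMean (p : ℝ) (μ : Measure X) : Set (Measure X) :=
  {ν | ν ∈ Pp (X := X) p ∧ ∫ z, z ∂ν = ∫ y, y ∂μ}

/-- The mean-constrained risk functional `I^Mean(h) f`. -/
def IMean (μ : Measure X) (φ : ℝ → ℝ≥0∞) (p h : ℝ) (f : X → ℝ) : EReal :=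
  ⨆ ν ∈ PpMean p μ,
    ((∫ x, f x ∂ν : ℝ) : EReal) - ((phih φ h (Wp p μ ν).toReal : ℝ≥0∞) : EReal)

set_option linter.unusedSectionVars false

/-- The root mean squared displacement of the transport plan `π`. -/
def planCost (π : Measure (X × X)) : ℝ := √(∫ q, ‖q.2 - q.1‖ ^ 2 ∂π)

theorem planCost_nonneg (π : Measure (X × X)) : 0 ≤ planCost π := Real.sqrt_nonneg _

theorem sq_planCost (π : Measure (X × X)) : planCost π ^ 2 = ∫ q, ‖q.2 - q.1‖ ^ 2 ∂π :=
  Real.sq_sqrt (integral_nonneg fun _ => by positivity)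

theorem MeasureTheory.integral_norm_mul_norm_le_sqrt {α E F : Type*} {m : MeasurableSpace α}
    [NormedAddCommGroup E] [NormedAddCommGroup F] {μ : Measure α} {u : α → E} {v : α → F}
    (hu : MemLp u 2 μ) (hv : MemLp v 2 μ) :
    ∫ x, ‖u x‖ * ‖v x‖ ∂μ ≤ √(∫ x, ‖u x‖ ^ 2 ∂μ) * √(∫ x, ‖v x‖ ^ 2 ∂μ) := by
  have h2 : (2 : ℝ).HolderConjugate 2 := Real.HolderConjugate.two_two
  have := integral_mul_le_Lp_mul_Lq_of_nonneg (μ := μ) h2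
    (f := fun x => ‖u x‖) (g := fun x => ‖v x‖)
    (Eventually.of_forall fun _ => norm_nonneg _) (Eventually.of_forall fun _ => norm_nonneg _)
    (by simpa using hu.norm) (by simpa using hv.norm)
  simpa [Real.sqrt_eq_rpow] using this

theorem MeasureTheory.MemLp.integrable_norm_mul_norm {α E F : Type*} {m : MeasurableSpace α}
    [NormedAddCommGroup E] [NormedAddCommGroup F] {μ : Measure α} {u : α → E} {v : α → F}
    (hu : MemLp u 2 μ) (hv : MemLp v 2 μ) : Integrable (fun x => ‖u x‖ * ‖v x‖) μ :=
  hu.norm.integrable_mul hv.norm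

theorem MeasureTheory.MemLp.integrable_real_inner {α : Type*} {m : MeasurableSpace α}
    {μ : Measure α} {u v : α → X} (hu : MemLp u 2 μ) (hv : MemLp v 2 μ) :
    Integrable (fun x => ⟪u x, v x⟫) μ :=
  (hu.integrable_norm_mul_norm hv).mono' (hu.1.inner hv.1)
    (Eventually.of_forall fun _ => norm_inner_le_norm _ _)

theorem ContDiff.continuous_gradient {f : X → ℝ} (hf : ContDiff ℝ 1 f) :
    Continuous (gradient f) :=
  (InnerProductSpace.toDual ℝ X).symm.continuous.comp (hf.continuous_fderiv one_ne_zero)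

theorem abs_sub_sub_inner_gradient_le {f : X → ℝ} (hf : Differentiable ℝ f) {y z : X} {B : ℝ}
    (hB : ∀ u ∈ segment ℝ y z, ‖gradient f u - gradient f y‖ ≤ B) :
    |f z - f y - ⟪gradient f y, z - y⟫| ≤ B * ‖z - y‖ := by
  have := (convex_segment (𝕜 := ℝ) y z).norm_image_sub_le_of_norm_fderiv_le' (f := f)
    (φ := fderiv ℝ f y) (C := B) (fun u _ => hf u) (fun u hu => ?_)
    (left_mem_segment ℝ y z) (right_mem_segment ℝ y z)
  · simpa [gradient] using this
  · have h := hB u hu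
    rwa [gradient, gradient, ← map_sub, LinearIsometryEquiv.norm_map] at h

theorem abs_sub_sub_inner_gradient_le_of_linear_growth {f : X → ℝ} (hf : Differentiable ℝ f) {C : ℝ}
    (hC : 0 ≤ C) (hfC : ∀ x, ‖gradient f x‖ ≤ C * (1 + ‖x‖)) (y z : X) :
    |f z - f y - ⟪gradient f y, z - y⟫| ≤ 2 * C * (1 + ‖y‖) * ‖z - y‖ + C * ‖z - y‖ ^ 2 := by
  have := abs_sub_sub_inner_gradient_le hf (y := y) (z := z)
    (B := 2 * C * (1 + ‖y‖) + C * ‖z - y‖) fun u hu => by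
      have h1 : ‖u‖ ≤ ‖y‖ + ‖z - y‖ := by
        obtain ⟨t, ⟨ht0, ht1⟩, rfl⟩ := (segment_eq_image' ℝ y z) ▸ hu
        refine (norm_add_le _ _).trans ?_
        rw [norm_smul, Real.norm_of_nonneg ht0]
        nlinarith [norm_nonneg (z - y)]
      have h2 := norm_sub_le (gradient f u) (gradient f y)
      have h3 := hfC u
      have h4 := hfC y
      nlinarith
  linarith

theorem exists_measurableSet_oscillation_le {E : Type*} [NormedAddCommGroup E] {v : X → E}
    (hv : Continuous v) {ε : ℝ} (hε : 0 < ε) :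
    ∃ S : ℕ → Set X, (∀ n, MeasurableSet (S n)) ∧ (∀ y, ∀ᶠ n in atTop, y ∈ S n) ∧
      ∀ n, ∀ y ∈ S n, ‖y‖ ≤ n ∧ ∀ u, ‖u‖ ≤ 1 / ((n : ℝ) + 1) → ‖v (y + u) - v y‖ ≤ ε := by
  refine ⟨fun n => {y | ‖y‖ ≤ n} ∩
    ⋂ u ∈ Metric.closedBall (0 : X) (1 / ((n : ℝ) + 1)), {y | ‖v (y + u) - v y‖ ≤ ε},
    fun n => ?_, fun y => ?_, fun n y hy => ⟨hy.1, fun u hu =>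
      mem_iInter₂.1 hy.2 u (mem_closedBall_zero_iff.2 hu)⟩⟩
  · refine IsClosed.measurableSet ((isClosed_le continuous_norm continuous_const).inter ?_)
    refine isClosed_biInter fun u _ => isClosed_le ?_ continuous_const
    fun_prop
  · obtain ⟨δ, hδ, hy⟩ := Metric.continuous_iff.1 hv y ε hε
    have h1 : ∀ᶠ n : ℕ in atTop, 1 / ((n : ℝ) + 1) < δ :=
      tendsto_one_div_add_atTop_nhds_zero_nat.eventually (gt_mem_nhds hδ)
    have h2 : ∀ᶠ n : ℕ in atTop, ‖y‖ ≤ n := tendsto_natCast_atTop_atTop.eventually_ge_atTop _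
    filter_upwards [h1, h2] with n h1 h2
    refine ⟨h2, mem_iInter₂.2 fun u hu => ?_⟩
    have := hy (y + u) (by
      rw [dist_eq_norm, add_sub_cancel_left]; exact (mem_closedBall_zero_iff.1 hu).trans_lt h1)
    rw [dist_eq_norm] at this
    exact this.le

theorem tendsto_integral_norm_sq_const_add_indicator {μ : Measure X} [IsProbabilityMeasure μ]
    {G : X → ℝ} (hG : MemLp G 2 μ) (hG0 : ∀ y, 0 ≤ G y) {S : ℕ → Set X}
    (hS : ∀ n, MeasurableSet (S n)) (hS_ev : ∀ y, ∀ᶠ n in atTop, y ∈ S n) {a : ℝ} (ha : 0 ≤ a) :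
    Tendsto (fun n => ∫ y, ‖a + (S n)ᶜ.indicator G y‖ ^ 2 ∂μ) atTop (𝓝 (a ^ 2)) := by
  have hconst : ∫ _, a ^ 2 ∂μ = a ^ 2 := by simp
  rw [← hconst]
  refine tendsto_integral_of_dominated_convergence (fun y => (a + G y) ^ 2)
    (fun n => (((memLp_const a).add (hG.indicator (hS n).compl)).1.norm.pow 2))
    ((memLp_const a).add hG).integrable_sq (fun n => ?_) ?_
  · refine Eventually.of_forall fun y => ?_
    have h1 : 0 ≤ (S n)ᶜ.indicator G y := indicator_nonneg (fun y _ => hG0 y) y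
    have h2 : (S n)ᶜ.indicator G y ≤ G y := indicator_le_self' (fun _ _ => hG0 y) y
    rw [Real.norm_of_nonneg (by positivity), Real.norm_of_nonneg (by positivity)]
    gcongr
  · refine Eventually.of_forall fun y => tendsto_const_nhds.congr' ?_
    filter_upwards [hS_ev y] with n hn
    simp [hn]

/-- First-order Taylor expansion with a remainder whose linear coefficient is small in `L²`. -/
theorem exists_taylor_remainder {μ : Measure X} [IsProbabilityMeasure μ]
    (hμ : MemLp (fun x : X => x) 2 μ) {f : X → ℝ} (hf : ContDiff ℝ 1 f) {C : ℝ}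
    (hC : 0 ≤ C) (hfC : ∀ x, ‖gradient f x‖ ≤ C * (1 + ‖x‖)) {ε : ℝ} (hε : 0 < ε) :
    ∃ g : X → ℝ, MemLp g 2 μ ∧ (∀ y, 0 ≤ g y) ∧ ∫ y, ‖g y‖ ^ 2 ∂μ ≤ ε ^ 2 ∧ ∃ K : ℝ, 0 ≤ K ∧
      ∀ y z, |f z - f y - ⟪gradient f y, z - y⟫| ≤ g y * ‖z - y‖ + K * ‖z - y‖ ^ 2 := by
  have hdiff := hf.differentiable one_ne_zero
  obtain ⟨S, hS, hS_ev, hS_le⟩ :=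
    exists_measurableSet_oscillation_le hf.continuous_gradient (half_pos hε)
  have hG0 : ∀ y : X, 0 ≤ 2 * C * (1 + ‖y‖) := fun y => by positivity
  have hG : MemLp (fun y : X => 2 * C * (1 + ‖y‖)) 2 μ :=
    ((memLp_const (1 : ℝ)).add hμ.norm).const_mul (2 * C)
  obtain ⟨n, hn⟩ := ((tendsto_integral_norm_sq_const_add_indicator hG hG0 hS hS_ev
    (half_pos hε).le).eventually_le_const (u := ε ^ 2) (by nlinarith)).exists
  have hmem : MemLp (fun y => ε / 2 + (S n)ᶜ.indicator (fun y : X => 2 * C * (1 + ‖y‖)) y) 2 μ :=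
    (memLp_const (ε / 2)).add (hG.indicator (hS n).compl)
  have hK : 0 ≤ 2 * C * (1 + (n : ℝ)) * (n + 1) + C := by positivity
  refine ⟨_, hmem, fun y => ?_, hn, _, hK, fun y z => ?_⟩
  · exact add_nonneg (half_pos hε).le (indicator_nonneg (fun y _ => hG0 y) y)
  by_cases hy : y ∈ S n
  · have hy' : y ∉ (S n)ᶜ := fun h => h hy
    simp only [indicator_of_notMem hy', add_zero]
    by_cases hz : ‖z - y‖ ≤ 1 / ((n : ℝ) + 1)
    · refine (abs_sub_sub_inner_gradient_le hdiff (B := ε / 2) fun u hu => ?_).trans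
        (le_add_of_nonneg_right (by positivity))
      obtain ⟨t, ⟨ht0, ht1⟩, rfl⟩ := (segment_eq_image' ℝ y z) ▸ hu
      refine (hS_le n y hy).2 (t • (z - y)) ?_
      rw [norm_smul, Real.norm_of_nonneg ht0]
      exact (mul_le_of_le_one_left (norm_nonneg _) ht1).trans hz
    · refine (abs_sub_sub_inner_gradient_le_of_linear_growth hdiff hC hfC y z).trans ?_
      have h1 : 1 ≤ (n + 1) * ‖z - y‖ := by
        rw [not_le, div_lt_iff₀ (by positivity)] at hz
        linarith
      have h2 : ‖y‖ ≤ n := (hS_le n y hy).1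
      have h3 : 2 * C * (1 + ‖y‖) * ‖z - y‖ ≤
          2 * C * (1 + n) * ‖z - y‖ * ((n + 1) * ‖z - y‖) := by
        calc _ ≤ 2 * C * (1 + n) * ‖z - y‖ := by gcongr
          _ ≤ _ := le_mul_of_one_le_right (by positivity) h1
      have h4 : 0 ≤ ε / 2 * ‖z - y‖ := by positivity
      linarith
  · refine (abs_sub_sub_inner_gradient_le_of_linear_growth hdiff hC hfC y z).trans ?_
    simp only [indicator_of_mem (show y ∈ (S n)ᶜ from hy)]
    have h1 : 0 ≤ ε / 2 * ‖z - y‖ := by positivity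
    have h2 : 0 ≤ 2 * C * (1 + n) * (n + 1) * ‖z - y‖ ^ 2 := by positivity
    linarith

theorem mem_Pp_two_iff {ν : Measure X} :
    ν ∈ Pp (X := X) 2 ↔ IsProbabilityMeasure ν ∧ MemLp (fun x : X => x) 2 ν := by
  refine and_congr_right fun _ => ?_
  have := eLpNorm_lt_top_iff_lintegral_rpow_enorm_lt_top (μ := ν) (f := fun x : X => x)
    (p := 2) (by simp) (by simp)
  rw [ENNReal.toReal_ofNat] at this
  exact this.symm.trans ⟨fun h => ⟨aestronglyMeasurable_id, h⟩, fun h => h.2⟩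

section Coupling

variable {μ ν : Measure X} {π : Measure (X × X)}

theorem IsCoupling.isProbabilityMeasure [IsProbabilityMeasure μ] (h : IsCoupling μ ν π) :
    IsProbabilityMeasure π := by
  refine ⟨?_⟩
  have := h.1 ▸ (measure_univ : μ univ = 1)
  rwa [Measure.map_apply measurable_fst MeasurableSet.univ] at this

theorem IsCoupling.memLp_fst (h : IsCoupling μ ν π) {E : Type*} [NormedAddCommGroup E]
    {u : X → E} {p : ℝ≥0∞} (hu : MemLp u p μ) : MemLp (fun q : X × X => u q.1) p π := by
  rw [← h.1] at hu
  exact (memLp_map_measure_iff hu.1 measurable_fst.aemeasurable).1 hu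

theorem IsCoupling.memLp_snd (h : IsCoupling μ ν π) {E : Type*} [NormedAddCommGroup E]
    {u : X → E} {p : ℝ≥0∞} (hu : MemLp u p ν) : MemLp (fun q : X × X => u q.2) p π := by
  rw [← h.2] at hu
  exact (memLp_map_measure_iff hu.1 measurable_snd.aemeasurable).1 hu

theorem IsCoupling.integral_fst (h : IsCoupling μ ν π) {E : Type*} [NormedAddCommGroup E]
    [NormedSpace ℝ E] {u : X → E} (hu : AEStronglyMeasurable u μ) :
    ∫ q, u q.1 ∂π = ∫ x, u x ∂μ := by
  rw [← h.1] at hu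
  rw [← h.1, integral_map measurable_fst.aemeasurable hu]

theorem IsCoupling.integral_snd (h : IsCoupling μ ν π) {E : Type*} [NormedAddCommGroup E]
    [NormedSpace ℝ E] {u : X → E} (hu : AEStronglyMeasurable u ν) :
    ∫ q, u q.2 ∂π = ∫ x, u x ∂ν := by
  rw [← h.2] at hu
  rw [← h.2, integral_map measurable_snd.aemeasurable hu]

theorem IsCoupling.memLp_sub (h : IsCoupling μ ν π) (hμ : MemLp (fun x : X => x) 2 μ)
    (hν : MemLp (fun x : X => x) 2 ν) : MemLp (fun q : X × X => q.2 - q.1) 2 π :=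
  (h.memLp_snd hν).sub (h.memLp_fst hμ)

theorem IsCoupling.lintegral_eq (h : IsCoupling μ ν π) (hμ : MemLp (fun x : X => x) 2 μ)
    (hν : MemLp (fun x : X => x) 2 ν) :
    ∫⁻ q, (‖q.1 - q.2‖₊ : ℝ≥0∞) ^ (2 : ℝ) ∂π = ENNReal.ofReal (planCost π ^ 2) := by
  rw [sq_planCost, ofReal_integral_eq_lintegral_ofReal
    ((h.memLp_sub hμ hν).integrable_norm_pow (p := 2) two_ne_zero)
    (Eventually.of_forall fun _ => by positivity)]
  refine lintegral_congr fun q => ?_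
  rw [ENNReal.ofReal_pow (norm_nonneg _), ofReal_norm, ENNReal.rpow_two, ← nnnorm_neg, neg_sub]
  rfl

theorem IsCoupling.Wp_le (h : IsCoupling μ ν π) (hμ : MemLp (fun x : X => x) 2 μ)
    (hν : MemLp (fun x : X => x) 2 ν) : Wp 2 μ ν ≤ ENNReal.ofReal (planCost π) := by
  rw [Wp, one_div, ENNReal.rpow_inv_le_iff two_pos, ENNReal.rpow_two,
    ← ENNReal.ofReal_pow (planCost_nonneg π), ← h.lintegral_eq hμ hν]
  exact iInf₂_le (f := fun (π : Measure (X × X)) (_ : π ∈ {π | IsCoupling μ ν π}) =>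
    ∫⁻ q, (‖q.1 - q.2‖₊ : ℝ≥0∞) ^ (2 : ℝ) ∂π) π h

theorem IsCoupling.toReal_Wp_le (h : IsCoupling μ ν π) (hμ : MemLp (fun x : X => x) 2 μ)
    (hν : MemLp (fun x : X => x) 2 ν) : (Wp 2 μ ν).toReal ≤ planCost π :=
  ENNReal.toReal_le_of_le_ofReal (planCost_nonneg π) (h.Wp_le hμ hν)

theorem isCoupling_prod (μ ν : Measure X) [IsProbabilityMeasure μ] [IsProbabilityMeasure ν] :
    IsCoupling μ ν (μ.prod ν) :=
  ⟨by simp [Measure.map_fst_prod], by simp [Measure.map_snd_prod]⟩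

theorem exists_isCoupling_planCost_lt [IsProbabilityMeasure μ] [IsProbabilityMeasure ν]
    (hμ : MemLp (fun x : X => x) 2 μ) (hν : MemLp (fun x : X => x) 2 ν) {t : ℝ}
    (ht : (Wp 2 μ ν).toReal < t) : ∃ π, IsCoupling μ ν π ∧ planCost π < t := by
  have ht0 : 0 < t := ENNReal.toReal_nonneg.trans_lt ht
  have hfin : Wp 2 μ ν ≠ ⊤ :=
    ne_top_of_le_ne_top ENNReal.ofReal_ne_top ((isCoupling_prod μ ν).Wp_le hμ hν)
  have hlt := (ENNReal.lt_ofReal_iff_toReal_lt hfin).2 ht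
  rw [Wp, one_div, ENNReal.rpow_inv_lt_iff two_pos] at hlt
  obtain ⟨π, hπ⟩ := iInf_lt_iff.1 hlt
  obtain ⟨hc, hπ⟩ := iInf_lt_iff.1 hπ
  refine ⟨π, hc, ?_⟩
  have hc : IsCoupling μ ν π := hc
  rw [hc.lintegral_eq hμ hν, ENNReal.rpow_two, ← ENNReal.ofReal_pow ht0.le,
    ENNReal.ofReal_lt_ofReal_iff (by positivity)] at hπ
  exact lt_of_pow_lt_pow_left₀ 2 ht0.le hπ

end Coupling

theorem integrable_of_gradient_linear_growth {ν : Measure X} [IsProbabilityMeasure ν]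
    (hν : MemLp (fun x : X => x) 2 ν) {f : X → ℝ} (hf : ContDiff ℝ 1 f) {C : ℝ}
    (hC : 0 ≤ C) (hfC : ∀ x, ‖gradient f x‖ ≤ C * (1 + ‖x‖)) : Integrable f ν := by
  have hbound : Integrable (fun z : X => |f 0| + 3 * C * ‖z‖ + C * ‖z‖ ^ 2) ν :=
    ((integrable_const _).add ((hν.integrable one_le_two).norm.const_mul _)).add
      ((hν.integrable_norm_pow (p := 2) two_ne_zero).const_mul _)
  refine hbound.mono' hf.continuous.aestronglyMeasurable (Eventually.of_forall fun z => ?_)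
  have h1 := abs_sub_sub_inner_gradient_le_of_linear_growth (hf.differentiable one_ne_zero)
    hC hfC 0 z
  have h2 : |⟪gradient f 0, z⟫| ≤ C * ‖z‖ := by
    refine (abs_real_inner_le_norm _ _).trans ?_
    have := hfC 0
    rw [norm_zero, add_zero, mul_one] at this
    gcongr
  rw [sub_zero, norm_zero, add_zero, mul_one] at h1
  rw [Real.norm_eq_abs, abs_le]
  rw [abs_le] at h1 h2
  have h3 := abs_le.1 (le_refl |f 0|)
  constructor <;> linarith

theorem memLp_gradient {μ : Measure X} [IsProbabilityMeasure μ]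
    (hμ : MemLp (fun x : X => x) 2 μ) {f : X → ℝ} (hf : ContDiff ℝ 1 f) {C : ℝ}
    (hfC : ∀ x, ‖gradient f x‖ ≤ C * (1 + ‖x‖)) : MemLp (gradient f) 2 μ := by
  have hG : MemLp (fun y : X => 1 + ‖y‖) 2 μ := (memLp_const (1 : ℝ)).add hμ.norm
  refine hG.of_le_mul (c := C) hf.continuous_gradient.aestronglyMeasurable
    (Eventually.of_forall fun x => ?_)
  rw [Real.norm_of_nonneg (by positivity)]
  exact hfC x

/-- First-order expansion of `ν ↦ ∫ f dν` around `μ`, uniform over all plans from `μ` to measures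
with the same barycenter. -/
theorem exists_uniform_expansion {μ : Measure X} [IsProbabilityMeasure μ]
    (hμ : MemLp (fun x : X => x) 2 μ) {f : X → ℝ} (hf : ContDiff ℝ 1 f) {C : ℝ}
    (hC : 0 ≤ C) (hfC : ∀ x, ‖gradient f x‖ ≤ C * (1 + ‖x‖)) (m : X) {ε : ℝ} (hε : 0 < ε) :
    ∃ K : ℝ, 0 ≤ K ∧ ∀ (ν : Measure X) (π : Measure (X × X)), IsProbabilityMeasure ν →
      MemLp (fun x : X => x) 2 ν → ∫ z, z ∂ν = ∫ y, y ∂μ → IsCoupling μ ν π →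
      |∫ x, f x ∂ν - ∫ x, f x ∂μ - ∫ q, ⟪gradient f q.1 - m, q.2 - q.1⟫ ∂π| ≤
        ε * planCost π + K * planCost π ^ 2 := by
  obtain ⟨g, hg, hg0, hgε, K, hK, htaylor⟩ := exists_taylor_remainder hμ hf hC hfC hε
  refine ⟨K, hK, fun ν π _ hν hbary hπ => ?_⟩
  have := hπ.isProbabilityMeasure
  have hd := hπ.memLp_sub hμ hν
  have hfμ := integrable_of_gradient_linear_growth hμ hf hC hfC
  have hfν := integrable_of_gradient_linear_growth hν hf hC hfC
  have hf1 : Integrable (fun q : X × X => f q.1) π :=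
    memLp_one_iff_integrable.1 (hπ.memLp_fst (memLp_one_iff_integrable.2 hfμ))
  have hf2 : Integrable (fun q : X × X => f q.2) π :=
    memLp_one_iff_integrable.1 (hπ.memLp_snd (memLp_one_iff_integrable.2 hfν))
  have hi : Integrable (fun q : X × X => ⟪gradient f q.1, q.2 - q.1⟫) π :=
    (hπ.memLp_fst (memLp_gradient hμ hf hfC)).integrable_real_inner hd
  have hm : ∫ q, ⟪m, q.2 - q.1⟫ ∂π = 0 := by
    rw [integral_inner (hd.integrable one_le_two),
      integral_sub ((hπ.memLp_snd hν).integrable one_le_two)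
        ((hπ.memLp_fst hμ).integrable one_le_two),
      hπ.integral_snd hν.1, hπ.integral_fst hμ.1, hbary, sub_self, inner_zero_right]
  have hlin : ∫ q, ⟪gradient f q.1 - m, q.2 - q.1⟫ ∂π =
      ∫ q, ⟪gradient f q.1, q.2 - q.1⟫ ∂π := by
    simp_rw [inner_sub_left (gradient f _) m]
    rw [integral_sub hi ((memLp_const m).integrable_real_inner hd), hm, sub_zero]
  have heq : ∫ x, f x ∂ν - ∫ x, f x ∂μ - ∫ q, ⟪gradient f q.1 - m, q.2 - q.1⟫ ∂π =
      ∫ q, (f q.2 - f q.1 - ⟪gradient f q.1, q.2 - q.1⟫) ∂π := by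
    have hf21 : Integrable (fun q : X × X => f q.2 - f q.1) π := hf2.sub hf1
    rw [hlin, integral_sub hf21 hi, integral_sub hf2 hf1,
      hπ.integral_snd hfν.1, hπ.integral_fst hfμ.1]
  have hgd : Integrable (fun q : X × X => ‖g q.1‖ * ‖q.2 - q.1‖) π :=
    (hπ.memLp_fst hg).integrable_norm_mul_norm hd
  have hdd : Integrable (fun q : X × X => K * ‖q.2 - q.1‖ ^ 2) π :=
    (hd.integrable_norm_pow (p := 2) two_ne_zero).const_mul K
  rw [heq, ← Real.norm_eq_abs]
  refine (norm_integral_le_of_norm_le (hgd.add hdd) (Eventually.of_forall fun q => ?_)).trans ?_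
  · simpa [abs_of_nonneg (hg0 q.1)] using htaylor q.1 q.2
  · have hsplit : ∫ q, ((fun q : X × X => ‖g q.1‖ * ‖q.2 - q.1‖) +
        fun q : X × X => K * ‖q.2 - q.1‖ ^ 2) q ∂π =
        ∫ q, ‖g q.1‖ * ‖q.2 - q.1‖ ∂π + K * planCost π ^ 2 := by
      rw [sq_planCost, ← integral_const_mul]
      exact integral_add hgd hdd
    rw [hsplit]
    have hcs := integral_norm_mul_norm_le_sqrt (hπ.memLp_fst hg) hd
    rw [hπ.integral_fst (u := fun x => ‖g x‖ ^ 2) (hg.1.norm.pow 2)] at hcs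
    have hsqrt : √(∫ x, ‖g x‖ ^ 2 ∂μ) ≤ ε := Real.sqrt_le_iff.2 ⟨hε.le, hgε⟩
    have : ∫ q, ‖g q.1‖ * ‖q.2 - q.1‖ ∂π ≤ ε * planCost π :=
      hcs.trans (mul_le_mul_of_nonneg_right hsqrt (planCost_nonneg π))
    linarith

theorem lpnorm_two (μ : Measure X) (θ : X → X) : lpnorm μ 2 θ = √(∫ y, ‖θ y‖ ^ 2 ∂μ) := by
  simp [lpnorm, Real.sqrt_eq_rpow]

theorem lpnorm_two_nonneg (μ : Measure X) (θ : X → X) : 0 ≤ lpnorm μ 2 θ := by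
  rw [lpnorm_two]
  exact Real.sqrt_nonneg _

theorem lpnorm_two_smul (μ : Measure X) (θ : X → X) {b : ℝ} (hb : 0 ≤ b) :
    lpnorm μ 2 (fun x => b • θ x) = b * lpnorm μ 2 θ := by
  simp_rw [lpnorm_two, norm_smul, mul_pow, integral_const_mul, Real.norm_eq_abs, sq_abs]
  rw [Real.sqrt_mul (sq_nonneg b), Real.sqrt_sq hb]

section Shift

variable {μ : Measure X} {η : X → X}

theorem isCoupling_map_shift (hη : Measurable η) :
    IsCoupling μ (μ.map fun y => y + η y) (μ.map fun y => (y, y + η y)) := by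
  have hm : Measurable fun y => (y, y + η y) := by fun_prop
  constructor
  · rw [Measure.map_map measurable_fst hm]
    exact Measure.map_id
  · rw [Measure.map_map measurable_snd hm]
    rfl

theorem planCost_map_shift (hη : Measurable η) :
    planCost (μ.map fun y => (y, y + η y)) = lpnorm μ 2 η := by
  rw [planCost, lpnorm_two, integral_map (by fun_prop)
    (Continuous.aestronglyMeasurable (by fun_prop))]
  simp

theorem memLp_map_shift (hμ : MemLp (fun x : X => x) 2 μ) (hη : Measurable η)
    (hη2 : MemLp η 2 μ) : MemLp (fun x : X => x) 2 (μ.map fun y => y + η y) :=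
  (memLp_map_measure_iff aestronglyMeasurable_id (by fun_prop)).2 (hμ.add hη2)

theorem map_shift_mem_PpMean [IsProbabilityMeasure μ] (hμ : MemLp (fun x : X => x) 2 μ)
    (hη : Measurable η) (hη2 : MemLp η 2 μ) (hη0 : ∫ y, η y ∂μ = 0) :
    (μ.map fun y => y + η y) ∈ PpMean 2 μ := by
  refine ⟨mem_Pp_two_iff.2 ⟨Measure.isProbabilityMeasure_map (by fun_prop),
    memLp_map_shift hμ hη hη2⟩, ?_⟩
  rw [integral_map (f := fun x => x) (by fun_prop) aestronglyMeasurable_id,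
    integral_add (hμ.integrable one_le_two) (hη2.integrable one_le_two), hη0, add_zero]

end Shift

theorem exists_quadratic_lower_bound {φ : ℝ → ℝ≥0∞}
    (h : 0 < liminf (fun v : ℝ => φ v / ENNReal.ofReal (v ^ (2 : ℝ))) atTop) :
    ∃ c : ℝ, 0 < c ∧ ∀ᶠ v in atTop, ENNReal.ofReal (c * v ^ 2) ≤ φ v := by
  obtain ⟨r, -, hr0, hr⟩ := ENNReal.lt_iff_exists_real_btwn.1 h
  refine ⟨r, ENNReal.ofReal_pos.1 hr0, ?_⟩
  filter_upwards [eventually_lt_of_lt_liminf hr] with v hv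
  rw [ENNReal.ofReal_mul (ENNReal.ofReal_pos.1 hr0).le]
  rw [Real.rpow_two] at hv
  exact ENNReal.mul_le_of_le_div hv.le

theorem EReal.coe_sub_le_coe_of_ofReal_le {a m s : ℝ} {e : ℝ≥0∞} (he : ENNReal.ofReal s ≤ e)
    (h : a - s ≤ m) : (a : EReal) - (e : EReal) ≤ m := by
  have h1 : (s : EReal) ≤ (e : EReal) := by
    refine le_trans ?_ (EReal.coe_ennreal_le_coe_ennreal_iff.2 he)
    rw [EReal.coe_ennreal_ofReal]
    exact EReal.coe_le_coe_iff.2 (le_max_left _ _)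
  refine (EReal.sub_le_sub le_rfl h1).trans ?_
  exact_mod_cast h

theorem EReal.coe_sub_le_coe_of_le {a m : ℝ} {e : ℝ≥0∞} (h : a ≤ m) :
    (a : EReal) - (e : EReal) ≤ m :=
  EReal.coe_sub_le_coe_of_ofReal_le (s := 0) (by simp) (by simpa using h)

theorem EReal.coe_sub_le_coe_sub_add {a a' d : ℝ} {e : EReal} (h : a ≤ a' + d) :
    (a : EReal) - e ≤ (a' - e) + d := by
  have : (a : EReal) ≤ a' + d := by exact_mod_cast h
  refine (EReal.sub_le_sub this le_rfl).trans_eq ?_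
  rw [sub_eq_add_neg, sub_eq_add_neg, add_right_comm]

/-- If `A` and `B` are eventually finite, `B ≤ A`, and `A ≤ B + o(h)`, then
`(A - B) / h` tends to zero. -/
theorem EReal.tendsto_inv_mul_sub_zero {A B : ℝ → EReal}
    (hB : ∀ᶠ h in 𝓝[>] (0 : ℝ), B h ≠ ⊥) (hA : ∀ᶠ h in 𝓝[>] (0 : ℝ), A h ≠ ⊤)
    (hBA : ∀ᶠ h in 𝓝[>] (0 : ℝ), B h ≤ A h)
    (hAB : ∀ δ > 0, ∀ᶠ h in 𝓝[>] (0 : ℝ), A h ≤ B h + ((h * δ : ℝ) : EReal)) :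
    Tendsto (fun h : ℝ => ((h⁻¹ : ℝ) : EReal) * (A h - B h)) (𝓝[>] 0) (𝓝 0) := by
  have hfin : ∀ᶠ h in 𝓝[>] (0 : ℝ), ∃ a b : ℝ, A h = a ∧ B h = b ∧ b ≤ a := by
    filter_upwards [hB, hA, hBA] with h h1 h2 h3
    have hA' := EReal.coe_toReal h2 (ne_bot_of_le_ne_bot h1 h3)
    have hB' := EReal.coe_toReal (ne_top_of_le_ne_top h2 h3) h1
    refine ⟨_, _, hA'.symm, hB'.symm, ?_⟩
    rw [← hA', ← hB'] at h3
    exact_mod_cast h3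
  have hreal : Tendsto (fun h : ℝ => h⁻¹ * ((A h).toReal - (B h).toReal)) (𝓝[>] 0) (𝓝 0) := by
    refine Metric.tendsto_nhds.2 fun δ hδ => ?_
    filter_upwards [hfin, hAB (δ / 2) (half_pos hδ), self_mem_nhdsWithin]
      with h ⟨a, b, ha, hb, hba⟩ hle (hh : 0 < h)
    rw [ha, hb] at hle ⊢
    have hle' : a ≤ b + h * (δ / 2) := by exact_mod_cast hle
    rw [EReal.toReal_coe, EReal.toReal_coe, Real.dist_eq, sub_zero,
      abs_of_nonneg (mul_nonneg (inv_nonneg.2 hh.le) (_root_.sub_nonneg.2 hba)), inv_mul_lt_iff₀ hh]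
    nlinarith
  refine (EReal.tendsto_coe.2 hreal).congr' ?_
  filter_upwards [hfin] with h ⟨a, b, ha, hb, _⟩
  rw [ha, hb]
  norm_cast

section MeanConstrained

variable {μ : Measure X} [IsProbabilityMeasure μ] {f : X → ℝ} {C : ℝ} {m : X}

theorem exists_integral_le_of_mem_PpMean (hμ : MemLp (fun x : X => x) 2 μ)
    (hf : ContDiff ℝ 1 f) (hC : 0 ≤ C) (hfC : ∀ x, ‖gradient f x‖ ≤ C * (1 + ‖x‖)) (m : X)
    {ε : ℝ} (hε : 0 < ε) :
    ∃ K : ℝ, 0 ≤ K ∧ ∀ ν ∈ PpMean 2 μ, ∫ x, f x ∂ν ≤ ∫ x, f x ∂μ +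
      (lpnorm μ 2 (fun x => gradient f x - m) + ε) * (Wp 2 μ ν).toReal +
        K * (Wp 2 μ ν).toReal ^ 2 := by
  obtain ⟨K, hK, hexp⟩ := exists_uniform_expansion hμ hf hC hfC m hε
  refine ⟨K, hK, fun ν ⟨hν, hbary⟩ => ?_⟩
  obtain ⟨hprob, hν⟩ := mem_Pp_two_iff.1 hν
  set T := lpnorm μ 2 (fun x => gradient f x - m) with hT
  have hT0 : 0 ≤ T := lpnorm_two_nonneg _ _
  have hθ : MemLp (fun x => gradient f x - m) 2 μ :=
    (memLp_gradient hμ hf hfC).sub (memLp_const m)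
  have key : ∀ t, (Wp 2 μ ν).toReal < t →
      ∫ x, f x ∂ν ≤ ∫ x, f x ∂μ + (T + ε) * t + K * t ^ 2 := fun t ht => by
    obtain ⟨π, hπ, hlt⟩ := exists_isCoupling_planCost_lt hμ hν ht
    have hd := hπ.memLp_sub hμ hν
    have hθπ := hπ.memLp_fst hθ
    have hcs : ∫ q, ⟪gradient f q.1 - m, q.2 - q.1⟫ ∂π ≤ T * planCost π := by
      calc _ ≤ ∫ q, ‖gradient f q.1 - m‖ * ‖q.2 - q.1‖ ∂π :=
            integral_mono (hθπ.integrable_real_inner hd) (hθπ.integrable_norm_mul_norm hd)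
              fun q => real_inner_le_norm _ _
        _ ≤ _ := integral_norm_mul_norm_le_sqrt hθπ hd
        _ = _ := by
          rw [hπ.integral_fst (u := fun x => ‖gradient f x - m‖ ^ 2) (hθ.1.norm.pow 2),
            hT, lpnorm_two, planCost]
    have h1 := (abs_le.1 (hexp ν π hprob hν hbary hπ)).2
    have h2 := planCost_nonneg π
    have h3 : T * planCost π ≤ T * t := by gcongr
    have h4 : ε * planCost π ≤ ε * t := by gcongr
    have h5 : K * planCost π ^ 2 ≤ K * t ^ 2 := by gcongr
    linarith
  refine ge_of_tendsto (x := 𝓝[>] (Wp 2 μ ν).toReal)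
    (f := fun t => ∫ x, f x ∂μ + (T + ε) * t + K * t ^ 2) ?_
    (eventually_nhdsWithin_of_forall key)
  exact (Continuous.tendsto (by fun_prop) _).mono_left nhdsWithin_le_nhds

theorem smul_gradient_sub_shift_mem_PpMean (hμ : MemLp (fun x : X => x) 2 μ)
    (hf : ContDiff ℝ 1 f) (hfC : ∀ x, ‖gradient f x‖ ≤ C * (1 + ‖x‖))
    (hm : m = ∫ y, gradient f y ∂μ) (b : ℝ) :
    (μ.map fun y => y + b • (gradient f y - m)) ∈ PpMean 2 μ := by
  have hgrad := memLp_gradient hμ hf hfC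
  refine map_shift_mem_PpMean hμ
    ((hf.continuous_gradient.sub continuous_const).const_smul b).measurable
    ((hgrad.sub (memLp_const m)).const_smul b) ?_
  rw [integral_smul, integral_sub (hgrad.integrable one_le_two) (integrable_const _), ← hm]
  simp

theorem toReal_Wp_smul_gradient_sub_shift_le (hμ : MemLp (fun x : X => x) 2 μ)
    (hf : ContDiff ℝ 1 f) (hfC : ∀ x, ‖gradient f x‖ ≤ C * (1 + ‖x‖)) (b : ℝ) :
    (Wp 2 μ (μ.map fun y => y + b • (gradient f y - m))).toReal ≤
      lpnorm μ 2 (fun x => b • (gradient f x - m)) := by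
  have hη : Measurable fun x => b • (gradient f x - m) :=
    ((hf.continuous_gradient.sub continuous_const).const_smul b).measurable
  have hη2 : MemLp (fun x => b • (gradient f x - m)) 2 μ :=
    ((memLp_gradient hμ hf hfC).sub (memLp_const m)).const_smul b
  rw [← planCost_map_shift hη]
  exact (isCoupling_map_shift hη).toReal_Wp_le hμ (memLp_map_shift hμ hη hη2)

theorem exists_le_integral_smul_gradient_sub_shift (hμ : MemLp (fun x : X => x) 2 μ)
    (hf : ContDiff ℝ 1 f) (hC : 0 ≤ C) (hfC : ∀ x, ‖gradient f x‖ ≤ C * (1 + ‖x‖))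
    (hm : m = ∫ y, gradient f y ∂μ) {ε : ℝ} (hε : 0 < ε) :
    ∃ K : ℝ, 0 ≤ K ∧ ∀ b : ℝ, 0 ≤ b → ∀ V, V = b * lpnorm μ 2 (fun x => gradient f x - m) →
      ∫ x, f x ∂μ + (lpnorm μ 2 (fun x => gradient f x - m) - ε) * V - K * V ^ 2 ≤
        ∫ x, f x ∂(μ.map fun y => y + b • (gradient f y - m)) := by
  obtain ⟨K, hK, hexp⟩ := exists_uniform_expansion hμ hf hC hfC m hε
  refine ⟨K, hK, fun b hb V hV => ?_⟩
  have hη : Measurable fun x => b • (gradient f x - m) :=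
    ((hf.continuous_gradient.sub continuous_const).const_smul b).measurable
  obtain ⟨hν, hbary⟩ := smul_gradient_sub_shift_mem_PpMean hμ hf hfC hm b
  obtain ⟨hprob, hν⟩ := mem_Pp_two_iff.1 hν
  have h1 := (abs_le.1 (hexp _ _ hprob hν hbary (isCoupling_map_shift hη))).1
  have hgradc := hf.continuous_gradient
  have hinner : ∫ q, ⟪gradient f q.1 - m, q.2 - q.1⟫
      ∂(μ.map fun y => (y, y + b • (gradient f y - m))) =
      lpnorm μ 2 (fun x => gradient f x - m) * V := by
    rw [integral_map (by fun_prop) (Continuous.aestronglyMeasurable (by fun_prop))]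
    simp_rw [add_sub_cancel_left, real_inner_smul_right, real_inner_self_eq_norm_sq]
    rw [integral_const_mul, hV, mul_left_comm, lpnorm_two,
      Real.mul_self_sqrt (integral_nonneg fun _ => by positivity)]
  rw [hinner, planCost_map_shift hη, lpnorm_two_smul μ _ hb, ← hV] at h1
  linarith

end MeanConstrained

theorem stmt3 (p : ℝ) (hp : p = 2)
    (μ : Measure X) (hμ : μ ∈ Pp (X := X) p)
    (φ : ℝ → ℝ≥0∞) (hmono : MonotoneOn φ (Ici (0 : ℝ))) (hzero : φ 0 = 0)
    (hgrowth : 0 < liminf (fun v : ℝ => φ v / ENNReal.ofReal (v ^ p)) atTop)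
    (f : X → ℝ) (hf : MemC1p p f)
    (θ : X → X) (hθ : θ = fun x => gradient f x - ∫ y, gradient f y ∂μ)
    (Θ : Set (X → X)) (hΘ : Θ = {g | ∃ b : ℝ, 0 ≤ b ∧ g = fun x => b • θ x}) :
    Tendsto (fun h : ℝ => ((h⁻¹ : ℝ) : EReal) * (IMean μ φ p h f - ITheta μ φ p Θ h f))
      (𝓝[>] (0 : ℝ)) (𝓝 (0 : EReal)) := by
  subst hp
  obtain ⟨hprob, hμ⟩ := mem_Pp_two_iff.1 hμ
  obtain ⟨hf, C, hC, hfC⟩ := hf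
  norm_num at hfC
  generalize hm : ∫ y, gradient f y ∂μ = m at hθ
  have hT0 : 0 ≤ lpnorm μ 2 θ := lpnorm_two_nonneg _ _
  obtain ⟨c, hc, hquad⟩ := exists_quadratic_lower_bound hgrowth
  obtain ⟨v₀, hv₀⟩ := eventually_atTop.1 hquad
  -- Beyond the radius `v₁ h` the penalty dominates the gain.
  obtain ⟨v₁, hv₁0, hv₁v₀, hv₁c⟩ : ∃ v₁ : ℝ, 0 < v₁ ∧ v₀ ≤ v₁ ∧
      2 * (lpnorm μ 2 θ + 1) ≤ c * v₁ := by
    refine ⟨max (max 1 v₀) (2 * (lpnorm μ 2 θ + 1) / c), by positivity, by simp, ?_⟩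
    rw [← div_le_iff₀' hc]
    exact le_max_right _ _
  have hpos : ∀ᶠ h in 𝓝[>] (0 : ℝ), 0 < h := self_mem_nhdsWithin
  have hsmall : ∀ {a : ℝ}, 0 < a → ∀ k : ℝ, ∀ᶠ h in 𝓝[>] (0 : ℝ), k * h < a := fun ha k => by
    have : Tendsto (fun h => k * h) (𝓝[>] (0 : ℝ)) (𝓝 (k * 0)) :=
      (Continuous.tendsto (by fun_prop) _).mono_left nhdsWithin_le_nhds
    exact this.eventually_lt_const (by simpa using ha)
  have hfar : ∀ᶠ h in 𝓝[>] (0 : ℝ), ∀ ν ∈ PpMean 2 μ, (Wp 2 μ ν).toReal ≤ v₁ * h ∨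
      ((∫ x, f x ∂ν : ℝ) : EReal) - ((phih φ h (Wp 2 μ ν).toReal : ℝ≥0∞) : EReal) ≤
        ((∫ x, f x ∂μ : ℝ) : EReal) := by
    obtain ⟨K, hK, hle⟩ := exists_integral_le_of_mem_PpMean hμ hf hC hfC m one_pos
    filter_upwards [hpos, hsmall hc (2 * K)] with h hh hKh ν hν
    refine or_iff_not_imp_left.2 fun hW => ?_
    have hle := hle ν hν
    rw [← hθ] at hle
    set W := (Wp 2 μ ν).toReal
    rw [not_le, ← lt_div_iff₀ hh] at hW
    have hWh : W = W / h * h := (div_mul_cancel₀ _ hh.ne').symm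
    generalize W / h = w at hW hWh
    refine EReal.coe_sub_le_coe_of_ofReal_le (s := h * (c * w ^ 2)) ?_ ?_
    · rw [phih, ENNReal.ofReal_mul hh.le, hWh, mul_div_cancel_right₀ _ hh.ne']
      gcongr
      exact hv₀ w (hv₁v₀.trans hW.le)
    · rw [hWh] at hle
      have hw0 : 0 < w := hv₁0.trans hW
      have h1 : 2 * (lpnorm μ 2 θ + 1) ≤ c * w := hv₁c.trans (by gcongr)
      have h2 : (lpnorm μ 2 θ + 1) * (w * h) ≤ c * w / 2 * (w * h) := by
        gcongr
        linarith
      have h3 : K * h * (w ^ 2 * h) ≤ c / 2 * (w ^ 2 * h) := by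
        gcongr
        linarith
      linarith
  have hITheta : ∀ h b : ℝ, 0 ≤ b → ((∫ x, f x ∂(μ.map fun y => y + b • (gradient f y - m)) : ℝ) :
      EReal) - ((phih φ h (b * lpnorm μ 2 θ) : ℝ≥0∞) : EReal) ≤ ITheta μ φ 2 Θ h f :=
    fun h b hb => by
      rw [← lpnorm_two_smul μ θ hb, hθ]
      exact le_iSup₂_of_le (fun x => b • (gradient f x - m)) (by rw [hΘ, hθ]; exact ⟨b, hb, rfl⟩)
        le_rfl
  have hbase : ∀ h : ℝ, ((∫ x, f x ∂μ : ℝ) : EReal) ≤ ITheta μ φ 2 Θ h f := fun h => by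
    simpa [phih, hzero] using hITheta h 0 le_rfl
  refine EReal.tendsto_inv_mul_sub_zero (Eventually.of_forall fun h => ?_) ?_ ?_ fun δ hδ => ?_
  · exact ne_bot_of_le_ne_bot (EReal.coe_ne_bot _) (hbase h)
  · obtain ⟨K, hK, hle⟩ := exists_integral_le_of_mem_PpMean hμ hf hC hfC m one_pos
    filter_upwards [hfar] with h hfar
    refine ne_top_of_le_ne_top (EReal.coe_ne_top (max (∫ x, f x ∂μ)
      (∫ x, f x ∂μ + (lpnorm μ 2 θ + 1) * (v₁ * h) + K * (v₁ * h) ^ 2)))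
      (iSup₂_le fun ν hν => ?_)
    rcases hfar ν hν with hW | hW
    · refine EReal.coe_sub_le_coe_of_le (le_max_of_le_right ((hle ν hν).trans ?_))
      rw [← hθ]
      gcongr
    · exact hW.trans (EReal.coe_le_coe_iff.2 (le_max_left _ _))
  · filter_upwards [hpos] with h hh
    refine iSup₂_le fun η hη => ?_
    rw [hΘ, hθ] at hη
    obtain ⟨b, hb, rfl⟩ := hη
    refine le_iSup₂_of_le _ (smul_gradient_sub_shift_mem_PpMean hμ hf hfC hm.symm b)
      (EReal.sub_le_sub le_rfl (EReal.coe_ennreal_le_coe_ennreal_iff.2 ?_))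
    rw [phih, phih]
    gcongr
    refine hmono (div_nonneg ENNReal.toReal_nonneg hh.le)
      (div_nonneg (lpnorm_two_nonneg _ _) hh.le) ?_
    gcongr
    exact toReal_Wp_smul_gradient_sub_shift_le hμ hf hfC b
  · have hε : 0 < δ / (4 * v₁) := by positivity
    obtain ⟨K, hK, hup⟩ := exists_integral_le_of_mem_PpMean hμ hf hC hfC m hε
    obtain ⟨L, hL, hlow⟩ :=
      exists_le_integral_smul_gradient_sub_shift hμ hf hC hfC hm.symm hε
    filter_upwards [hpos, hfar, hsmall (half_pos hδ) ((K + L) * v₁ ^ 2)] with h hh hfar hKL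
    refine iSup₂_le fun ν hν => ?_
    rcases hfar ν hν with hW | hW
    · have hup := hup ν hν
      rw [← hθ] at hup hlow
      have hW0 : 0 ≤ (Wp 2 μ ν).toReal := ENNReal.toReal_nonneg
      generalize (Wp 2 μ ν).toReal = W at hW hup hW0
      have h1 : δ / (4 * v₁) * W ≤ h * δ / 4 := by
        calc _ ≤ δ / (4 * v₁) * (v₁ * h) := by gcongr
          _ = _ := by field_simp
      have h2 : (K + L) * W ^ 2 ≤ h * δ / 2 := by
        calc _ ≤ (K + L) * (v₁ * h) ^ 2 := by gcongr
          _ = ((K + L) * v₁ ^ 2 * h) * h := by ring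
          _ ≤ δ / 2 * h := by gcongr
          _ = _ := by ring
      have hLW : 0 ≤ L * W ^ 2 := by positivity
      rcases hT0.eq_or_lt with hT | hT
      · refine (EReal.coe_sub_le_coe_of_le (m := ∫ x, f x ∂μ + h * δ) ?_).trans ?_
        · rw [← hT, zero_add] at hup
          have : 0 < h * δ := by positivity
          linarith
        · rw [EReal.coe_add]
          gcongr
          exact hbase h
      · have hV : W = W / lpnorm μ 2 θ * lpnorm μ 2 θ := (div_mul_cancel₀ _ hT.ne').symm
        have hb : 0 ≤ W / lpnorm μ 2 θ := by positivity
        have hI := hITheta h _ hb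
        rw [← hV] at hI
        refine (EReal.coe_sub_le_coe_sub_add (d := h * δ) ?_).trans
          (add_le_add_left hI _)
        have hlow := hlow _ hb W hV
        linarith
    · refine (hW.trans (hbase h)).trans (le_add_of_nonneg_right ?_)
      exact_mod_cast (by positivity : 0 ≤ h * δ)
end
end
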